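/- arXiv:1103.1721 — 8 statements merged into one kernel-verified Lean document; each statement's English description precedes it below -/
import Mathlib

section
/- The ordered monomials y^i x^j e^k, for (i,j,k) ranging over ℕ³, form a basis of S(A,f,n) as an A-module: they are A-linearly independent and they span S(A,f,n) over A. -/
namespace SmithAlgebraStmt

variable (A : Type*) [CommRing A]

/-- The generator `x` of the free algebra on three generators. -/
noncomputable def gX : FreeAlgebra A (Fin 3) := FreeAlgebra.ι A 0
/-- The generator `y` of the free algebra on three generators. -/
noncomputable def gY : FreeAlgebra A (Fin 3) := FreeAlgebra.ι A 1
/-- The generator `e` of the free algebra on three generators. -/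
noncomputable def gE : FreeAlgebra A (Fin 3) := FreeAlgebra.ι A 2

/-- The defining relations of the Smith algebra `S(A,f,n)`:
`e*x − x*e = n•x`, `e*y − y*e = −n•y`, `y*x − x*y = f(e)`. -/
inductive SmithRel (n : ℕ) (f : Polynomial A) :
    FreeAlgebra A (Fin 3) → FreeAlgebra A (Fin 3) → Prop
  | ex : SmithRel n f (gE A * gX A - gX A * gE A) (n • gX A)
  | ey : SmithRel n f (gE A * gY A - gY A * gE A) (-(n • gY A))
  | yx : SmithRel n f (gY A * gX A - gX A * gY A) (Polynomial.aeval (gE A) f)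

/-- The Smith algebra `S(A,f,n)`: the quotient of the free `A`-algebra on three
generators `x, y, e` by the two-sided ideal generated by the elements
`e*x − x*e − n•x`, `e*y − y*e + n•y` and `y*x − x*y − f(e)`. -/
abbrev Smith (n : ℕ) (f : Polynomial A) := RingQuot (SmithRel A n f)

/-- The image of `x` in the Smith algebra. -/
noncomputable def x (n : ℕ) (f : Polynomial A) : Smith A n f :=
  RingQuot.mkAlgHom A (SmithRel A n f) (gX A)
/-- The image of `y` in the Smith algebra. -/
noncomputable def y (n : ℕ) (f : Polynomial A) : Smith A n f :=
  RingQuot.mkAlgHom A (SmithRel A n f) (gY A)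
/-- The image of `e` in the Smith algebra. -/
noncomputable def e (n : ℕ) (f : Polynomial A) : Smith A n f :=
  RingQuot.mkAlgHom A (SmithRel A n f) (gE A)

section Spanning

variable {R S : Type*} [CommRing R] [Ring S] [Algebra R S]

/-- The subalgebra of elements whose left multiplication preserves a submodule. -/
def leftStabilizer (W : Submodule R S) : Subalgebra R S where
  carrier := {s | ∀ w ∈ W, s * w ∈ W}
  mul_mem' := fun {a b} ha hb w hw => by
    rw [mul_assoc]
    exact ha _ (hb _ hw)
  add_mem' := fun {a b} ha hb w hw => by
    rw [add_mul]
    exact W.add_mem (ha _ hw) (hb _ hw)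
  algebraMap_mem' := fun r w hw => by
    rw [← Algebra.smul_def]
    exact W.smul_mem r hw

theorem mem_leftStabilizer {W : Submodule R S} {s : S} :
    s ∈ leftStabilizer W ↔ ∀ w ∈ W, s * w ∈ W := Iff.rfl

theorem mem_leftStabilizer_span {T : Set S} {s : S}
    (h : ∀ t ∈ T, s * t ∈ Submodule.span R T) :
    s ∈ leftStabilizer (Submodule.span R T) := by
  intro w hw
  induction hw using Submodule.span_induction with
  | mem t ht => exact h t ht
  | zero => simp
  | add a b _ _ ha hb =>
    rw [mul_add]
    exact add_mem ha hb
  | smul r a _ ha =>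
    rw [mul_smul_comm]
    exact Submodule.smul_mem _ r ha

theorem mul_pow_of_commutator {e x c : S} (hc : Commute c x)
    (h : e * x - x * e = c * x) (j : ℕ) :
    e * x ^ j = x ^ j * e + j * (c * x ^ j) := by
  induction j with
  | zero => simp
  | succ j ih =>
    have h' : e * x = x * e + c * x := by rw [← h]; abel
    have hcj : x ^ j * c = c * x ^ j := ((hc.pow_right j).eq).symm
    calc e * x ^ (j + 1) = (e * x ^ j) * x := by rw [pow_succ, mul_assoc]
      _ = x ^ j * (e * x) + j * (c * (x ^ j * x)) := by rw [ih]; noncomm_ring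
      _ = x ^ j * x * e + (x ^ j * c) * x + j * (c * (x ^ j * x)) := by
        rw [h']; noncomm_ring
      _ = x ^ (j + 1) * e + ((j + 1 : ℕ) : S) * (c * x ^ (j + 1)) := by
        rw [hcj, pow_succ]; push_cast; noncomm_ring

theorem generators_mem_leftStabilizer {n : ℕ} {f : Polynomial R} {x y e : S}
    (hx : e * x - x * e = n • x) (hy : e * y - y * e = -(n • y))
    (hyx : y * x - x * y = Polynomial.aeval e f) :
    let W := Submodule.span R
      (Set.range fun p : ℕ × ℕ × ℕ => y ^ p.1 * x ^ p.2.1 * e ^ p.2.2)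
    x ∈ leftStabilizer W ∧ y ∈ leftStabilizer W ∧ e ∈ leftStabilizer W := by
  intro W
  have mon (i j k : ℕ) : y ^ i * x ^ j * e ^ k ∈ W := Submodule.subset_span ⟨(i, j, k), rfl⟩
  have hyW : y ∈ leftStabilizer W := by
    refine mem_leftStabilizer_span ?_
    rintro _ ⟨⟨i, j, k⟩, rfl⟩
    have := mon (i + 1) j k
    rwa [pow_succ', mul_assoc, mul_assoc, ← mul_assoc (y ^ i)] at this
  have heW : e ∈ leftStabilizer W := by
    refine mem_leftStabilizer_span ?_
    rintro _ ⟨⟨i, j, k⟩, rfl⟩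
    have ex := mul_pow_of_commutator (c := (n : S)) (Nat.cast_commute n x)
      (by rw [hx, nsmul_eq_mul]) j
    have ey := mul_pow_of_commutator (c := -(n : S)) (Nat.cast_commute n y).neg_left
      (by rw [hy, nsmul_eq_mul, neg_mul]) i
    have key : e * (y ^ i * x ^ j * e ^ k) = y ^ i * x ^ j * e ^ (k + 1)
        + ((j : ℤ) * n - i * n) • (y ^ i * x ^ j * e ^ k) := by
      have hji : y ^ i * ((j : S) * n) = ((j : S) * n) * y ^ i := by
        rw [← Nat.cast_mul]
        exact (Nat.cast_commute _ _).eq.symm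
      calc e * (y ^ i * x ^ j * e ^ k) = (e * y ^ i) * x ^ j * e ^ k := by noncomm_ring
        _ = y ^ i * (e * x ^ j) * e ^ k - (i : S) * n * (y ^ i * x ^ j * e ^ k) := by
          rw [ey]; noncomm_ring
        _ = y ^ i * x ^ j * (e * e ^ k) + (y ^ i * ((j : S) * n)) * x ^ j * e ^ k
            - (i : S) * n * (y ^ i * x ^ j * e ^ k) := by
          rw [ex]; noncomm_ring
        _ = _ := by
          rw [hji, ← pow_succ', zsmul_eq_mul]; push_cast; noncomm_ring
    change e * (y ^ i * x ^ j * e ^ k) ∈ W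
    rw [key]
    exact W.add_mem (mon _ _ _) (zsmul_mem (mon _ _ _) _)
  have hfW : Polynomial.aeval e f ∈ leftStabilizer W :=
    Algebra.adjoin_le (Set.singleton_subset_iff.2 heW) (Polynomial.aeval_mem_adjoin_singleton R e)
  refine ⟨mem_leftStabilizer_span ?_, hyW, heW⟩
  rintro _ ⟨⟨i, j, k⟩, rfl⟩
  change x * (y ^ i * x ^ j * e ^ k) ∈ W
  induction i with
  | zero =>
    have := mon 0 (j + 1) k
    rwa [pow_succ', pow_zero, one_mul, mul_assoc, ← one_mul (x ^ j), ← pow_zero y] at this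
  | succ i ih =>
    have key : x * (y ^ (i + 1) * x ^ j * e ^ k) =
        y * (x * (y ^ i * x ^ j * e ^ k))
          - Polynomial.aeval e f * (y ^ i * x ^ j * e ^ k) := by
      rw [← hyx, pow_succ']; noncomm_ring
    rw [key]
    exact W.sub_mem (hyW _ ih) (hfW _ (mon _ _ _))

end Spanning

section Relations

variable {R : Type*} [CommRing R] (n : ℕ) (f : Polynomial R)

theorem e_mul_x_sub : e R n f * x R n f - x R n f * e R n f = n • x R n f := by
  simpa [e, x] using RingQuot.mkAlgHom_rel R (SmithRel.ex (n := n) (f := f))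

theorem e_mul_y_sub : e R n f * y R n f - y R n f * e R n f = -(n • y R n f) := by
  simpa [e, y] using RingQuot.mkAlgHom_rel R (SmithRel.ey (n := n) (f := f))

theorem y_mul_x_sub :
    y R n f * x R n f - x R n f * y R n f = Polynomial.aeval (e R n f) f := by
  have h := RingQuot.mkAlgHom_rel R (SmithRel.yx (n := n) (f := f))
  rw [← Polynomial.aeval_algHom_apply] at h
  simpa [e, x, y] using h

theorem subalgebra_eq_top_of_generators_mem {B : Subalgebra R (Smith R n f)}
    (hx : x R n f ∈ B) (hy : y R n f ∈ B) (he : e R n f ∈ B) : B = ⊤ := by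
  refine Algebra.eq_top_iff.2 fun s => ?_
  obtain ⟨a, rfl⟩ := RingQuot.mkAlgHom_surjective R (SmithRel R n f) s
  induction a using FreeAlgebra.induction with
  | grade0 r => simp
  | grade1 i =>
    fin_cases i
    exacts [hx, hy, he]
  | mul a b ha hb =>
    rw [map_mul]
    exact B.mul_mem ha hb
  | add a b ha hb =>
    rw [map_add]
    exact B.add_mem ha hb

theorem span_monomials_eq_top :
    Submodule.span R (Set.range fun p : ℕ × ℕ × ℕ =>
      y R n f ^ p.1 * x R n f ^ p.2.1 * e R n f ^ p.2.2) = ⊤ := by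
  obtain ⟨hx, hy, he⟩ := generators_mem_leftStabilizer (e_mul_x_sub n f) (e_mul_y_sub n f)
    (y_mul_x_sub n f)
  have htop := subalgebra_eq_top_of_generators_mem n f hx hy he
  refine Submodule.eq_top_iff'.2 fun s => ?_
  have hs := mem_leftStabilizer.1 (Algebra.eq_top_iff.1 htop s) 1
    (Submodule.subset_span ⟨(0, 0, 0), by simp⟩)
  rwa [mul_one] at hs

end Relations

section Representation

open Polynomial

variable {R : Type*} [CommRing R]

/-- The operator on `ℕ → ℕ → R[X]` by which `y` acts; an array `m` stands for the formal sum
of the `y ^ i * x ^ j * (m i j)(e)`. -/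
noncomputable def opY : Module.End R (ℕ → ℕ → R[X]) where
  toFun m := fun i j => match i with
    | 0 => 0
    | i + 1 => m i j
  map_add' a b := by ext i j : 2; cases i <;> simp
  map_smul' r a := by ext i j : 2; cases i <;> simp

/-- The operator on `ℕ → ℕ → R[X]` by which `e` acts. -/
noncomputable def opE (n : ℕ) : Module.End R (ℕ → ℕ → R[X]) where
  toFun m := fun i j => (X + (n : R[X]) * ((j : R[X]) - (i : R[X]))) * m i j
  map_add' a b := by ext i j : 2; simp [mul_add]
  map_smul' r a := by ext i j : 2; simp

/-- The polynomial `∑ s < i, f (t + n * (j - s))`, which arises on moving `x` past `y ^ i` in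
`x * y ^ i * x ^ j`. -/
noncomputable def crossTerm (n : ℕ) (f : R[X]) (i j : ℕ) : R[X] :=
  ∑ s ∈ Finset.range i, f.comp (X + (n : R[X]) * ((j : R[X]) - (s : R[X])))

/-- The operator on `ℕ → ℕ → R[X]` by which `x` acts. -/
noncomputable def opX (n : ℕ) (f : R[X]) : Module.End R (ℕ → ℕ → R[X]) where
  toFun m := fun i j => (match j with
    | 0 => 0
    | j + 1 => m i j) - crossTerm n f (i + 1) j * m (i + 1) j
  map_add' a b := by ext i j : 2; cases j <;> simp <;> ring
  map_smul' r a := by ext i j : 2; cases j <;> simp [smul_sub]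

@[simp] theorem opY_zero (m : ℕ → ℕ → R[X]) (j : ℕ) : opY m 0 j = 0 := rfl

@[simp] theorem opY_succ (m : ℕ → ℕ → R[X]) (i j : ℕ) : opY m (i + 1) j = m i j := rfl

@[simp] theorem opE_apply (n : ℕ) (m : ℕ → ℕ → R[X]) (i j : ℕ) :
    opE n m i j = (X + (n : R[X]) * ((j : R[X]) - (i : R[X]))) * m i j := rfl

@[simp] theorem opX_zero (n : ℕ) (f : R[X]) (m : ℕ → ℕ → R[X]) (i : ℕ) :
    opX n f m i 0 = -(crossTerm n f (i + 1) 0 * m (i + 1) 0) := zero_sub _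

@[simp] theorem opX_succ (n : ℕ) (f : R[X]) (m : ℕ → ℕ → R[X]) (i j : ℕ) :
    opX n f m i (j + 1) = m i j - crossTerm n f (i + 1) (j + 1) * m (i + 1) (j + 1) := rfl

theorem aeval_opE_apply (n : ℕ) (f : R[X]) (m : ℕ → ℕ → R[X]) (i j : ℕ) :
    aeval (opE n) f m i j = f.comp (X + (n : R[X]) * ((j : R[X]) - (i : R[X]))) * m i j := by
  induction f using Polynomial.induction_on' with
  | add p q hp hq => simp [hp, hq, add_mul]
  | monomial k a =>
    have hpow : (opE n ^ k) m i j = (X + (n : R[X]) * ((j : R[X]) - (i : R[X]))) ^ k * m i j := by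
      induction k with
      | zero => simp
      | succ k ih => rw [pow_succ', Module.End.mul_apply, opE_apply, ih]; ring
    simp [aeval_monomial, Module.algebraMap_end_apply, hpow, smul_eq_C_mul, mul_assoc]

theorem opE_mul_opX_sub (n : ℕ) (f : R[X]) :
    opE n * opX n f - opX n f * opE n = n • opX n f := by
  ext m i j : 3
  cases j <;> simp <;> ring

theorem opE_mul_opY_sub (n : ℕ) :
    opE n * opY - opY * opE n = -(n • (opY : Module.End R (ℕ → ℕ → R[X]))) := by
  ext m i j : 3
  cases i with
  | zero => simp
  | succ i =>
    simp
    ring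

theorem opY_mul_opX_sub (n : ℕ) (f : R[X]) :
    opY * opX n f - opX n f * opY = aeval (opE n) f := by
  ext m i j : 3
  rw [aeval_opE_apply]
  cases i <;> cases j <;> simp [crossTerm, Finset.sum_range_succ] <;> ring_nf

/-- The representation of the Smith algebra on `ℕ → ℕ → R[X]`. -/
noncomputable def rep (n : ℕ) (f : R[X]) : Smith R n f →ₐ[R] Module.End R (ℕ → ℕ → R[X]) :=
  RingQuot.liftAlgHom R ⟨FreeAlgebra.lift R ![opX n f, opY, opE n], fun a b h => by
    cases h with
    | ex => simpa [gX, gE] using opE_mul_opX_sub n f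
    | ey => simpa [gY, gE] using opE_mul_opY_sub n
    | yx =>
      rw [← Polynomial.aeval_algHom_apply]
      simpa [gX, gY, gE] using opY_mul_opX_sub n f⟩

@[simp] theorem rep_x (n : ℕ) (f : R[X]) : rep n f (x R n f) = opX n f := by
  simp [rep, x, gX]

@[simp] theorem rep_y (n : ℕ) (f : R[X]) : rep n f (y R n f) = opY := by
  simp [rep, y, gY]

@[simp] theorem rep_e (n : ℕ) (f : R[X]) : rep n f (e R n f) = opE n := by
  simp [rep, e, gE]

/-- The array with the single possibly nonzero entry `g` at `(i, j)`. -/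
noncomputable def single (i j : ℕ) (g : R[X]) : ℕ → ℕ → R[X] :=
  fun i' j' => if i' = i ∧ j' = j then g else 0

theorem opY_pow_single (i j : ℕ) (g : R[X]) :
    (opY ^ i) (single 0 j g) = single i j g := by
  induction i with
  | zero => rfl
  | succ i ih =>
    rw [pow_succ', Module.End.mul_apply, ih]
    ext i' j' : 2
    cases i' <;> simp [single]

theorem opX_pow_single (n : ℕ) (f : R[X]) (j : ℕ) (g : R[X]) :
    (opX n f ^ j) (single 0 0 g) = single 0 j g := by
  induction j with
  | zero => rfl
  | succ j ih =>
    rw [pow_succ', Module.End.mul_apply, ih]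
    ext i' j' : 2
    cases j' <;> simp [single]

theorem opE_pow_single (n k : ℕ) :
    (opE n ^ k) (single 0 0 (1 : R[X])) = single 0 0 (X ^ k) := by
  induction k with
  | zero => rfl
  | succ k ih =>
    rw [pow_succ', Module.End.mul_apply, ih]
    ext i' j' : 2
    by_cases h : i' = 0 ∧ j' = 0
    · simp [single, h, pow_succ']
    · simp [single, h]

theorem rep_monomial_apply (n : ℕ) (f : R[X]) (i j k : ℕ) :
    rep n f (y R n f ^ i * x R n f ^ j * e R n f ^ k) (single 0 0 1) = single i j (X ^ k) := by
  simp only [map_mul, map_pow, rep_x, rep_y, rep_e, Module.End.mul_apply, opE_pow_single,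
    opX_pow_single, opY_pow_single]

/-- The `R`-linear form reading off the coefficient of `y ^ i * x ^ j * e ^ k`. -/
noncomputable def monomialCoeff (n : ℕ) (f : R[X]) (p : ℕ × ℕ × ℕ) : Smith R n f →ₗ[R] R :=
  Polynomial.lcoeff R p.2.2 ∘ₗ LinearMap.proj p.2.1 ∘ₗ LinearMap.proj p.1 ∘ₗ
    LinearMap.applyₗ (single 0 0 1) ∘ₗ (rep n f).toLinearMap

theorem monomialCoeff_monomial (n : ℕ) (f : R[X]) (p q : ℕ × ℕ × ℕ) :
    monomialCoeff n f p (y R n f ^ q.1 * x R n f ^ q.2.1 * e R n f ^ q.2.2) =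
      if p = q then 1 else 0 := by
  obtain ⟨i, j, k⟩ := p
  obtain ⟨i', j', k'⟩ := q
  change (rep n f _ (single 0 0 1) i j).coeff k = _
  rw [rep_monomial_apply]
  by_cases h : i = i' ∧ j = j'
  · simp [single, h, coeff_X_pow]
  · have h' : ¬(i = i' ∧ j = j' ∧ k = k') := fun h'' => h ⟨h''.1, h''.2.1⟩
    simp [single, h, h']

theorem linearIndependent_monomials (n : ℕ) (f : R[X]) :
    LinearIndependent R fun p : ℕ × ℕ × ℕ =>
      y R n f ^ p.1 * x R n f ^ p.2.1 * e R n f ^ p.2.2 := by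
  rw [linearIndependent_iff']
  intro s c hc p hp
  have h := congrArg (monomialCoeff n f p) hc
  simpa [-map_mul, monomialCoeff_monomial, hp] using h

end Representation

/-- The ordered monomials `y^i x^j e^k`, `(i,j,k) ∈ ℕ³`, form an
`A`-module basis of the Smith algebra `S(A,f,n)`: they are `A`-linearly independent
and they span `S(A,f,n)` over `A`. -/
theorem stmt_1 {A : Type*} [CommRing A] [IsDomain A] [Algebra ℂ A]
    (n : ℕ) (hn : 0 < n) (f : Polynomial A) :
    LinearIndependent A
      (fun p : ℕ × ℕ × ℕ => y A n f ^ p.1 * x A n f ^ p.2.1 * e A n f ^ p.2.2) ∧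
    Submodule.span A
      (Set.range fun p : ℕ × ℕ × ℕ =>
        y A n f ^ p.1 * x A n f ^ p.2.1 * e A n f ^ p.2.2) = ⊤ :=
  ⟨linearIndependent_monomials n f, span_monomials_eq_top n f⟩

end SmithAlgebraStmt
end

section
/- An element w of the Smith algebra S(A,f,n) commutes with e (i.e. e·w = w·e) if and only if w belongs to the A-subalgebra of S(A,f,n) generated by the two elements x·y and e; moreover this subalgebra coincides with the A-subalgebra generated by y·x and e. -/
namespace SmithAlgebraStmt

variable (A : Type*) [CommRing A]

/-- If `z * g ∈ C * z` for all `g` in `s`, then `z * c ∈ C * z` for all `c` in the subalgebra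
generated by `s`. -/
theorem exists_mul_eq_mul_of_mem_adjoin {A S : Type*} [CommRing A] [Ring S] [Algebra A S]
    (C : Subalgebra A S) (z : S) {s : Set S} (hs : ∀ g ∈ s, ∃ c' ∈ C, z * g = c' * z)
    {c : S} (hc : c ∈ Algebra.adjoin A s) : ∃ c' ∈ C, z * c = c' * z := by
  induction hc using Algebra.adjoin_induction with
  | mem g hg => exact hs g hg
  | algebraMap r => exact ⟨_, C.algebraMap_mem r, (Algebra.commutes r z).symm⟩
  | add a b _ _ ha hb =>
    obtain ⟨a', ha', ea⟩ := ha
    obtain ⟨b', hb', eb⟩ := hb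
    exact ⟨a' + b', add_mem ha' hb', by rw [mul_add, ea, eb, add_mul]⟩
  | mul a b _ _ ha hb =>
    obtain ⟨a', ha', ea⟩ := ha
    obtain ⟨b', hb', eb⟩ := hb
    exact ⟨a' * b', mul_mem ha' hb', by rw [← mul_assoc, ea, mul_assoc, eb, mul_assoc]⟩

theorem e_mul_x (A : Type*) [CommRing A] (n : ℕ) (f : Polynomial A) :
    e A n f * x A n f - x A n f * e A n f = n • x A n f := by
  have h := RingQuot.mkAlgHom_rel A (SmithRel.ex (A := A) (n := n) (f := f))
  rwa [map_sub, map_mul, map_mul, map_nsmul] at h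

theorem y_mul_e (A : Type*) [CommRing A] (n : ℕ) (f : Polynomial A) :
    y A n f * e A n f - e A n f * y A n f = n • y A n f := by
  have h := RingQuot.mkAlgHom_rel A (SmithRel.ey (A := A) (n := n) (f := f))
  rw [map_neg, map_sub, map_mul, map_mul, map_nsmul, ← neg_eq_iff_eq_neg, neg_sub] at h
  exact h

theorem y_mul_x (A : Type*) [CommRing A] (n : ℕ) (f : Polynomial A) :
    y A n f * x A n f - x A n f * y A n f = Polynomial.aeval (e A n f) f := by
  have h := RingQuot.mkAlgHom_rel A (SmithRel.yx (A := A) (n := n) (f := f))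
  rw [← Polynomial.aeval_algHom_apply] at h
  rwa [map_sub, map_mul, map_mul] at h

/-- An additive submonoid stable under scalars and left multiplication by the
generators is a left ideal. -/
theorem mul_mem_of_generators {A : Type*} [CommRing A] {n : ℕ} {f : Polynomial A}
    (M : AddSubmonoid (Smith A n f))
    (hr : ∀ (r : A), ∀ m ∈ M, algebraMap A _ r * m ∈ M)
    (hx : ∀ m ∈ M, x A n f * m ∈ M) (hy : ∀ m ∈ M, y A n f * m ∈ M)
    (he : ∀ m ∈ M, e A n f * m ∈ M) (w : Smith A n f) : ∀ m ∈ M, w * m ∈ M := by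
  obtain ⟨w, rfl⟩ := RingQuot.mkAlgHom_surjective A (SmithRel A n f) w
  induction w using FreeAlgebra.induction with
  | grade0 r => simpa only [AlgHom.commutes] using hr r
  | grade1 i => fin_cases i; exacts [hx, hy, he]
  | mul a b ha hb =>
    intro m hm
    rw [map_mul, mul_assoc]
    exact ha _ (hb m hm)
  | add a b ha hb =>
    intro m hm
    rw [map_add, add_mul]
    exact add_mem (ha m hm) (hb m hm)

theorem aeval_mem_adjoin {A S : Type*} [CommRing A] [Ring S] [Algebra A S] {s : Set S} {a : S}
    (ha : a ∈ s) (f : Polynomial A) : Polynomial.aeval a f ∈ Algebra.adjoin A s :=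
  Algebra.adjoin_mono (Set.singleton_subset_iff.2 ha) (Polynomial.aeval_mem_adjoin_singleton A a)

theorem adjoin_xy_eq_adjoin_yx (A : Type*) [CommRing A] (n : ℕ) (f : Polynomial A) :
    Algebra.adjoin A {x A n f * y A n f, e A n f} =
      Algebra.adjoin A {y A n f * x A n f, e A n f} := by
  have h := y_mul_x A n f
  apply le_antisymm <;> refine Algebra.adjoin_le ?_ <;> rintro _ (rfl | rfl)
  · rw [← sub_eq_iff_eq_add'.2 (sub_eq_iff_eq_add.1 h), SetLike.mem_coe]
    exact sub_mem (Algebra.subset_adjoin (by simp)) (aeval_mem_adjoin (by simp) f)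
  · exact Algebra.subset_adjoin (by simp)
  · rw [sub_eq_iff_eq_add.1 h, SetLike.mem_coe]
    exact add_mem (aeval_mem_adjoin (by simp) f) (Algebra.subset_adjoin (by simp))
  · exact Algebra.subset_adjoin (by simp)

theorem x_mul_mem (A : Type*) [CommRing A] (n : ℕ) (f : Polynomial A) {c : Smith A n f}
    (hc : c ∈ Algebra.adjoin A {x A n f * y A n f, e A n f}) :
    ∃ c' ∈ Algebra.adjoin A {x A n f * y A n f, e A n f}, x A n f * c = c' * x A n f := by
  rw [adjoin_xy_eq_adjoin_yx] at hc
  refine exists_mul_eq_mul_of_mem_adjoin _ _ ?_ hc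
  rintro _ (rfl | rfl)
  · exact ⟨_, Algebra.subset_adjoin (by simp), (mul_assoc _ _ _).symm⟩
  · refine ⟨e A n f - n • 1, sub_mem (Algebra.subset_adjoin (by simp))
      (nsmul_mem (one_mem _) n), ?_⟩
    rw [sub_mul, smul_mul_assoc, one_mul, ← e_mul_x, sub_sub_cancel]

theorem y_mul_mem (A : Type*) [CommRing A] (n : ℕ) (f : Polynomial A) {c : Smith A n f}
    (hc : c ∈ Algebra.adjoin A {x A n f * y A n f, e A n f}) :
    ∃ c' ∈ Algebra.adjoin A {x A n f * y A n f, e A n f}, y A n f * c = c' * y A n f := by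
  refine exists_mul_eq_mul_of_mem_adjoin _ _ ?_ hc
  rintro _ (rfl | rfl)
  · refine ⟨y A n f * x A n f, ?_, (mul_assoc _ _ _).symm⟩
    rw [adjoin_xy_eq_adjoin_yx]
    exact Algebra.subset_adjoin (by simp)
  · refine ⟨e A n f + n • 1, add_mem (Algebra.subset_adjoin (by simp))
      (nsmul_mem (one_mem _) n), ?_⟩
    rw [add_mul, smul_mul_assoc, one_mul, ← y_mul_e, add_sub_cancel]

/-- With `C` the subalgebra generated by `x * y` and `e`, the Smith algebra is the sum of the
`C * x ^ k` and the `C * y ^ k`. -/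
theorem mem_closure_monomials {A : Type*} [CommRing A] {n : ℕ} {f : Polynomial A}
    (w : Smith A n f) :
    w ∈ AddSubmonoid.closure {w : Smith A n f |
      ∃ c ∈ Algebra.adjoin A {x A n f * y A n f, e A n f}, ∃ k : ℕ,
        w = c * x A n f ^ k ∨ w = c * y A n f ^ k} := by
  set C := Algebra.adjoin A {x A n f * y A n f, e A n f} with hC
  have hxy : x A n f * y A n f ∈ C := Algebra.subset_adjoin (by simp)
  have hyx : y A n f * x A n f ∈ C := by
    rw [hC, adjoin_xy_eq_adjoin_yx]; exact Algebra.subset_adjoin (by simp)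
  set G := {w : Smith A n f | ∃ c ∈ C, ∃ k : ℕ, w = c * x A n f ^ k ∨ w = c * y A n f ^ k}
  have lift : ∀ z : Smith A n f, (∀ g ∈ G, z * g ∈ G) →
      ∀ m ∈ AddSubmonoid.closure G, z * m ∈ AddSubmonoid.closure G := by
    intro z hz m hm
    induction hm using AddSubmonoid.closure_induction with
    | mem g hg => exact AddSubmonoid.subset_closure (hz g hg)
    | zero => rw [mul_zero]; exact zero_mem _
    | add a b _ _ ha hb => rw [mul_add]; exact add_mem ha hb
  have hCG : ∀ z ∈ C, ∀ g ∈ G, z * g ∈ G := by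
    rintro z hz _ ⟨c, hc, k, rfl | rfl⟩
    exacts [⟨z * c, mul_mem hz hc, k, Or.inl (mul_assoc _ _ _).symm⟩,
      ⟨z * c, mul_mem hz hc, k, Or.inr (mul_assoc _ _ _).symm⟩]
  have key := mul_mem_of_generators (AddSubmonoid.closure G)
    (fun r => lift _ (hCG _ (C.algebraMap_mem r))) (lift _ ?_) (lift _ ?_)
    (lift _ (hCG _ (Algebra.subset_adjoin (by simp)))) w 1
    (AddSubmonoid.subset_closure ⟨1, one_mem _, 0, Or.inl (by simp)⟩)
  · rwa [mul_one] at key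
  · rintro _ ⟨c, hc, k, h⟩
    obtain ⟨c', hc', hcc⟩ := x_mul_mem A n f hc
    rcases h with rfl | rfl
    · exact ⟨c', hc', k + 1, Or.inl (by rw [← mul_assoc, hcc, mul_assoc, pow_succ'])⟩
    · cases k with
      | zero => exact ⟨c', hc', 1, Or.inl (by rw [pow_zero, mul_one, hcc, pow_one])⟩
      | succ k =>
        exact ⟨c' * (x A n f * y A n f), mul_mem hc' hxy, k,
          Or.inr (by rw [← mul_assoc, hcc, pow_succ']; simp only [mul_assoc])⟩
  · rintro _ ⟨c, hc, k, h⟩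
    obtain ⟨c', hc', hcc⟩ := y_mul_mem A n f hc
    rcases h with rfl | rfl
    · cases k with
      | zero => exact ⟨c', hc', 1, Or.inr (by rw [pow_zero, mul_one, hcc, pow_one])⟩
      | succ k =>
        exact ⟨c' * (y A n f * x A n f), mul_mem hc' hyx, k,
          Or.inl (by rw [← mul_assoc, hcc, pow_succ']; simp only [mul_assoc])⟩
    · exact ⟨c', hc', k + 1, Or.inr (by rw [← mul_assoc, hcc, mul_assoc, pow_succ'])⟩

theorem e_mul_eq_mul_e_of_mem_adjoin {A : Type*} [CommRing A] {n : ℕ} {f : Polynomial A}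
    {c : Smith A n f} (hc : c ∈ Algebra.adjoin A {x A n f * y A n f, e A n f}) :
    e A n f * c = c * e A n f := by
  have hle : Algebra.adjoin A {x A n f * y A n f, e A n f} ≤
      Subalgebra.centralizer A {e A n f} := by
    refine Algebra.adjoin_le ?_
    rintro _ (rfl | rfl)
    · rw [SetLike.mem_coe, Subalgebra.mem_centralizer_iff]
      rintro _ rfl
      rw [← mul_assoc, sub_eq_iff_eq_add.1 (e_mul_x A n f), add_mul, mul_assoc (x A n f),
        mul_assoc (x A n f), sub_eq_iff_eq_add.1 (y_mul_e A n f), mul_add, smul_mul_assoc,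
        mul_smul_comm]
    · rw [SetLike.mem_coe, Subalgebra.mem_centralizer_iff]
      rintro _ rfl
      rfl
  exact (Subalgebra.mem_centralizer_iff A).1 (hle hc) _ rfl

theorem commutator_eq_neg_smul {R S : Type*} [CommRing R] [Ring S] [Algebra R S] {a z : S}
    {μ : R} (h : z * a - a * z = μ • z) : a * z - z * a = (-μ) • z := by
  rw [neg_smul, ← h, neg_sub]

/-- If `c` commutes with `a` and `z` is an eigenvector of the commutator with `a`, then so is
`c * z ^ k`. -/
theorem commutator_mul_pow {R S : Type*} [CommRing R] [Ring S] [Algebra R S] {a c z : S} {μ : R}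
    (hc : a * c = c * a) (hz : a * z - z * a = μ • z) (k : ℕ) :
    a * (c * z ^ k) - c * z ^ k * a = (k * μ) • (c * z ^ k) := by
  induction k with
  | zero => simp [hc]
  | succ k ih =>
    have : a * (c * z ^ (k + 1)) - c * z ^ (k + 1) * a =
        (a * (c * z ^ k) - c * z ^ k * a) * z + c * z ^ k * (a * z - z * a) := by
      rw [pow_succ]; noncomm_ring
    rw [this, ih, hz, smul_mul_assoc, mul_smul_comm, mul_assoc c, ← pow_succ, ← add_smul]
    push_cast
    ring_nf

/-- An element `w` of `S(A,f,n)` commutes with `e` iff it lies in the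
`A`-subalgebra generated by `x·y` and `e`; moreover this subalgebra coincides with the
`A`-subalgebra generated by `y·x` and `e`. -/
theorem stmt_4 {A : Type*} [CommRing A] [IsDomain A] [Algebra ℂ A]
    (n : ℕ) (hn : 0 < n) (f : Polynomial A) :
    (∀ w : Smith A n f,
        e A n f * w = w * e A n f ↔
          w ∈ Algebra.adjoin A {x A n f * y A n f, e A n f}) ∧
    Algebra.adjoin A {x A n f * y A n f, e A n f} =
      Algebra.adjoin A {y A n f * x A n f, e A n f} := by
  refine ⟨fun w => ⟨fun hw => ?_, e_mul_eq_mul_e_of_mem_adjoin⟩, adjoin_xy_eq_adjoin_yx A n f⟩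
  let D : Module.End ℂ (Smith A n f) :=
    LinearMap.mulLeft ℂ (e A n f) - LinearMap.mulRight ℂ (e A n f)
  have hD : ∀ (μ : ℂ) (v : Smith A n f),
      v ∈ D.eigenspace μ ↔ e A n f * v - v * e A n f = μ • v := fun μ v => by
    rw [Module.End.mem_eigenspace_iff]
    rfl
  have hn' : (n : ℂ) ≠ 0 := by exact_mod_cast hn.ne'
  have hdec : ∃ c ∈ Algebra.adjoin A {x A n f * y A n f, e A n f},
      ∃ u ∈ ⨆ (μ : ℂ) (_ : μ ≠ 0), D.eigenspace μ, w = c + u := by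
    have heig : ∀ (z : Smith A n f) (μ : ℂ), μ ≠ 0 →
        e A n f * z - z * e A n f = μ • z →
        ∀ c ∈ Algebra.adjoin A {x A n f * y A n f, e A n f}, ∀ k : ℕ,
          ∃ c' ∈ Algebra.adjoin A {x A n f * y A n f, e A n f},
          ∃ u ∈ ⨆ (μ : ℂ) (_ : μ ≠ 0), D.eigenspace μ, c * z ^ k = c' + u := by
      intro z μ hμ hz c hc k
      rcases Nat.eq_zero_or_pos k with rfl | hk
      · exact ⟨c, hc, 0, zero_mem _, by simp⟩
      · have hne : (k : ℂ) * μ ≠ 0 := mul_ne_zero (by exact_mod_cast hk.ne') hμ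
        refine ⟨0, zero_mem _, c * z ^ k, ?_, (zero_add _).symm⟩
        exact Submodule.mem_iSup_of_mem _ (Submodule.mem_iSup_of_mem hne
          ((hD _ _).2 (commutator_mul_pow (e_mul_eq_mul_e_of_mem_adjoin hc) hz k)))
    clear hw
    induction mem_closure_monomials w using AddSubmonoid.closure_induction with
    | mem g hg =>
      obtain ⟨c, hc, k, rfl | rfl⟩ := hg
      · exact heig _ n hn' (by rw [e_mul_x, Nat.cast_smul_eq_nsmul]) c hc k
      · exact heig _ (-n) (neg_ne_zero.2 hn')
          (commutator_eq_neg_smul (by rw [y_mul_e, Nat.cast_smul_eq_nsmul])) c hc k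
    | zero => exact ⟨0, zero_mem _, 0, zero_mem _, (zero_add _).symm⟩
    | add a b _ _ ha hb =>
      obtain ⟨c, hc, u, hu, rfl⟩ := ha
      obtain ⟨d, hd, v, hv, rfl⟩ := hb
      exact ⟨c + d, add_mem hc hd, u + v, add_mem hu hv, add_add_add_comm _ _ _ _⟩
  obtain ⟨c, hc, u, hu, rfl⟩ := hdec
  have hu0 : u ∈ D.eigenspace 0 := by
    rw [hD, zero_smul, sub_eq_zero]
    rw [mul_add, add_mul, e_mul_eq_mul_e_of_mem_adjoin hc] at hw
    exact add_left_cancel hw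
  have : u = 0 := Submodule.disjoint_def.1 (D.eigenspaces_iSupIndep 0) u hu0 hu
  rwa [this, add_zero]

end SmithAlgebraStmt
end

section
/- For every natural number s, the A-linear maps A[t] → U(A,u,n) given by P ↦ x̃^s · P(ẽ) and by P ↦ ỹ^s · P(ẽ) are injective. In particular (taking s = 0) the subalgebra of U(A,u,n) generated over A by ẽ is a polynomial algebra over A. -/
namespace UAlgebraStmt

variable (A : Type*) [CommRing A]

/-- The generator `x̃` of the free algebra on three generators. -/
noncomputable def gX : FreeAlgebra A (Fin 3) := FreeAlgebra.ι A 0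
/-- The generator `ỹ` of the free algebra on three generators. -/
noncomputable def gY : FreeAlgebra A (Fin 3) := FreeAlgebra.ι A 1
/-- The generator `ẽ` of the free algebra on three generators. -/
noncomputable def gE : FreeAlgebra A (Fin 3) := FreeAlgebra.ι A 2

/-- The defining relations of the algebra `U(A,u,n)`:
`ẽ*x̃ − x̃*ẽ = n•x̃`, `ẽ*ỹ − ỹ*ẽ = −n•ỹ`, `x̃*ỹ = u(ẽ)`, `ỹ*x̃ = v(ẽ)`,
where `v(t) = u(t+n)`. -/
inductive URel (n : ℕ) (u : Polynomial A) :
    FreeAlgebra A (Fin 3) → FreeAlgebra A (Fin 3) → Prop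
  | ex : URel n u (gE A * gX A - gX A * gE A) (n • gX A)
  | ey : URel n u (gE A * gY A - gY A * gE A) (-(n • gY A))
  | xy : URel n u (gX A * gY A) (Polynomial.aeval (gE A) u)
  | yx : URel n u (gY A * gX A)
      (Polynomial.aeval (gE A) (u.comp (Polynomial.X + Polynomial.C (n : A))))

/-- The algebra `U(A,u,n)`: the quotient of the free `A`-algebra on three generators
`x̃, ỹ, ẽ` by the two-sided ideal generated by `ẽ*x̃ − x̃*ẽ − n•x̃`,
`ẽ*ỹ − ỹ*ẽ + n•ỹ`, `x̃*ỹ − u(ẽ)` and `ỹ*x̃ − v(ẽ)` where `v(t) = u(t+n)`. -/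
abbrev UAlg (n : ℕ) (u : Polynomial A) := RingQuot (URel A n u)

/-- The image of `x̃` in `U(A,u,n)`. -/
noncomputable def x (n : ℕ) (u : Polynomial A) : UAlg A n u :=
  RingQuot.mkAlgHom A (URel A n u) (gX A)
/-- The image of `ỹ` in `U(A,u,n)`. -/
noncomputable def y (n : ℕ) (u : Polynomial A) : UAlg A n u :=
  RingQuot.mkAlgHom A (URel A n u) (gY A)
/-- The image of `ẽ` in `U(A,u,n)`. -/
noncomputable def e (n : ℕ) (u : Polynomial A) : UAlg A n u :=
  RingQuot.mkAlgHom A (URel A n u) (gE A)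

/-- The weight of `ẽ` on the `k`-th basis vector: multiplication by `t + nk`. -/
noncomputable def weight (n : ℕ) (k : ℤ) : Polynomial A :=
  Polynomial.X + (n : Polynomial A) * (k : Polynomial A)

/-- The diagonal operator by which `ẽ` acts on `ℤ → A[t]`. -/
noncomputable def weightOp (n : ℕ) : Module.End A (ℤ → Polynomial A) :=
  Algebra.lmul A (ℤ → Polynomial A) (weight A n)

/-- The shift by `d` followed by multiplication by `p`: `f ↦ (k ↦ p k * f (k + d))`. -/
noncomputable def shiftOp (d : ℤ) (p : ℤ → Polynomial A) : Module.End A (ℤ → Polynomial A) :=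
  Algebra.lmul A (ℤ → Polynomial A) p ∘ₗ LinearMap.funLeft A (Polynomial A) (fun k => k + d)

section

variable {A}

theorem weightOp_apply (n : ℕ) (f : ℤ → Polynomial A) (k : ℤ) :
    weightOp A n f k = weight A n k * f k := rfl

theorem shiftOp_apply (d : ℤ) (p f : ℤ → Polynomial A) (k : ℤ) :
    shiftOp A d p f k = p k * f (k + d) := rfl

theorem aeval_weightOp_apply (n : ℕ) (P : Polynomial A) (f : ℤ → Polynomial A) (k : ℤ) :
    Polynomial.aeval (weightOp A n) P f k = Polynomial.aeval (weight A n k) P * f k := by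
  rw [weightOp, Polynomial.aeval_algHom_apply]
  exact congrArg (· * f k)
    (Polynomial.aeval_algHom_apply (Pi.evalAlgHom A (fun _ : ℤ => Polynomial A) k)
      (weight A n) P).symm

theorem shiftOp_one_pow_apply (d : ℤ) (s : ℕ) (f : ℤ → Polynomial A) (k : ℤ) :
    (shiftOp A d 1 ^ s) f k = f (k + s * d) := by
  induction s generalizing k with
  | zero => simp
  | succ s ih =>
    rw [pow_succ', Module.End.mul_apply, shiftOp_apply, ih, Pi.one_apply, one_mul]
    congr 1
    push_cast
    ring

/-- A factorization `p k * q (k - 1) = u (t + nk)` yields a weight representation of `U(A,u,n)`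
on `ℤ → A[t]`. -/
theorem exists_weight_representation (n : ℕ) (u : Polynomial A) (p q : ℤ → Polynomial A)
    (h : ∀ k, p k * q (k - 1) = Polynomial.aeval (weight A n k) u) :
    ∃ φ : UAlg A n u →ₐ[A] Module.End A (ℤ → Polynomial A),
      φ (x A n u) = shiftOp A (-1) p ∧ φ (y A n u) = shiftOp A 1 q ∧
        φ (e A n u) = weightOp A n := by
  let g : FreeAlgebra A (Fin 3) →ₐ[A] Module.End A (ℤ → Polynomial A) :=
    FreeAlgebra.lift A ![shiftOp A (-1) p, shiftOp A 1 q, weightOp A n]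
  have hx : g (gX A) = shiftOp A (-1) p := by simp [g, gX]
  have hy : g (gY A) = shiftOp A 1 q := by simp [g, gY]
  have he : g (gE A) = weightOp A n := by simp [g, gE]
  have hg : ∀ ⦃a b⦄, URel A n u a b → g a = g b := by
    intro a b hab
    cases hab with
    | ex =>
      simp only [map_sub, map_mul, map_nsmul, hx, he]
      refine LinearMap.ext fun f => funext fun k => ?_
      simp only [LinearMap.sub_apply, Module.End.mul_apply, LinearMap.smul_apply, Pi.sub_apply,
        Pi.smul_apply, shiftOp_apply, weightOp_apply, weight]
      rw [nsmul_eq_mul]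
      push_cast
      ring
    | ey =>
      simp only [map_sub, map_mul, map_neg, map_nsmul, hy, he]
      refine LinearMap.ext fun f => funext fun k => ?_
      simp only [LinearMap.sub_apply, LinearMap.neg_apply, Module.End.mul_apply,
        LinearMap.smul_apply, Pi.sub_apply, Pi.neg_apply, Pi.smul_apply, shiftOp_apply,
        weightOp_apply, weight]
      rw [nsmul_eq_mul]
      push_cast
      ring
    | xy =>
      rw [map_mul, ← Polynomial.aeval_algHom_apply, hx, hy, he]
      refine LinearMap.ext fun f => funext fun k => ?_
      rw [Module.End.mul_apply, shiftOp_apply, shiftOp_apply, aeval_weightOp_apply, ← h,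
        ← mul_assoc, neg_add_cancel_right, sub_eq_add_neg]
    | yx =>
      rw [map_mul, ← Polynomial.aeval_algHom_apply, hx, hy, he]
      refine LinearMap.ext fun f => funext fun k => ?_
      have hw : Polynomial.aeval (weight A n k) (Polynomial.X + Polynomial.C (n : A)) =
          weight A n (k + 1) := by
        simp only [map_add, Polynomial.aeval_X, map_natCast, weight]
        push_cast
        ring
      rw [Module.End.mul_apply, shiftOp_apply, shiftOp_apply, aeval_weightOp_apply,
        Polynomial.aeval_comp, hw, ← h, add_neg_cancel_right, add_sub_cancel_right]
      ring
  refine ⟨RingQuot.liftAlgHom A ⟨g, hg⟩, ?_, ?_, ?_⟩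
  · rw [x, RingQuot.liftAlgHom_mkAlgHom_apply, hx]
  · rw [y, RingQuot.liftAlgHom_mkAlgHom_apply, hy]
  · rw [e, RingQuot.liftAlgHom_mkAlgHom_apply, he]

/-- If a representation of an algebra on `ℤ → A[t]` sends `c` to the weight operator and `a` to
a pure shift, then `P ↦ a ^ s * P(c)` is injective. -/
theorem injective_pow_mul_aeval {B : Type*} [Ring B] [Algebra A B] (n : ℕ) (d : ℤ)
    (φ : B →ₐ[A] Module.End A (ℤ → Polynomial A)) {a c : B}
    (ha : φ a = shiftOp A d 1) (hc : φ c = weightOp A n) (s : ℕ) :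
    Function.Injective (fun P : Polynomial A => a ^ s * Polynomial.aeval c P) := by
  have key : ∀ P : Polynomial A, φ (a ^ s * Polynomial.aeval c P) 1 (-(s * d)) = P := by
    intro P
    rw [map_mul, map_pow, ← Polynomial.aeval_algHom_apply, ha, hc, Module.End.mul_apply,
      shiftOp_one_pow_apply, aeval_weightOp_apply, neg_add_cancel]
    simp [weight]
  exact Function.LeftInverse.injective (g := fun b => φ b 1 (-(s * d))) key

end

/-- For every `s : ℕ`, the `A`-linear maps `A[t] → U(A,u,n)` given by
`P ↦ x̃^s·P(ẽ)` and `P ↦ ỹ^s·P(ẽ)` are injective (in particular, for `s = 0`, the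
subalgebra generated over `A` by `ẽ` is a polynomial algebra). -/
theorem stmt_7 {A : Type*} [CommRing A] [IsDomain A] [Algebra ℂ A]
    (n : ℕ) (hn : 0 < n) (u : Polynomial A) (s : ℕ) :
    Function.Injective
      (fun P : Polynomial A => x A n u ^ s * Polynomial.aeval (e A n u) P) ∧
    Function.Injective
      (fun P : Polynomial A => y A n u ^ s * Polynomial.aeval (e A n u) P) := by
  constructor
  · obtain ⟨φ, hx, -, he⟩ := exists_weight_representation n u 1
      (fun k => Polynomial.aeval (weight A n (k + 1)) u) (fun k => by simp)
    exact injective_pow_mul_aeval n (-1) φ hx he s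
  · obtain ⟨φ, -, hy, he⟩ := exists_weight_representation n u
      (fun k => Polynomial.aeval (weight A n k) u) 1 (fun k => by simp)
    exact injective_pow_mul_aeval n 1 φ hy he s

end UAlgebraStmt
end

section
/- Every element w of U(A,u,n) can be written uniquely as a finite sum w = Σ_{ℓ≥1,k≥0} α_{k,ℓ} ỹ^ℓ ẽ^k + Σ_{m≥0,r≥0} β_{m,r} x̃^m ẽ^r with coefficients α_{k,ℓ}, β_{m,r} ∈ A; that is, the family consisting of the elements ỹ^ℓ ẽ^k (ℓ ≥ 1, k ≥ 0) together with the elements x̃^m ẽ^r (m ≥ 0, r ≥ 0) is a basis of U(A,u,n) as an A-module. -/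
namespace UAlgebraStmt

variable (A : Type*) [CommRing A]

section Spanning

variable {A : Type*} [CommRing A] (n : ℕ) (u : Polynomial A)

lemma mul_eq_mul_add_of_sub_eq_smul {B : Type*} [Ring B] [Algebra A B] {b z : B} {c : A}
    (h : b * z - z * b = c • z) : b * z = z * (b + algebraMap A B c) := by
  rw [sub_eq_iff_eq_add.mp h, mul_add, Algebra.smul_def, Algebra.commutes, add_comm]

lemma e_mul_x : e A n u * x A n u =
    x A n u * (e A n u + algebraMap A (UAlg A n u) (n : A)) := by
  refine mul_eq_mul_add_of_sub_eq_smul ?_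
  have h := RingQuot.mkAlgHom_rel A (URel.ex (A := A) (n := n) (u := u))
  rw [← Nat.cast_smul_eq_nsmul A] at h
  rwa [map_sub, map_mul, map_mul, map_smul] at h

lemma e_mul_y : e A n u * y A n u =
    y A n u * (e A n u + algebraMap A (UAlg A n u) (-(n : A))) := by
  refine mul_eq_mul_add_of_sub_eq_smul ?_
  have h := RingQuot.mkAlgHom_rel A (URel.ey (A := A) (n := n) (u := u))
  rw [← Nat.cast_smul_eq_nsmul A, ← neg_smul] at h
  rwa [map_sub, map_mul, map_mul, map_smul] at h

lemma x_mul_y : x A n u * y A n u = Polynomial.aeval (e A n u) u := by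
  have h := RingQuot.mkAlgHom_rel A (URel.xy (A := A) (n := n) (u := u))
  rwa [map_mul, ← Polynomial.aeval_algHom_apply] at h

lemma y_mul_x : y A n u * x A n u =
    Polynomial.aeval (e A n u) (u.comp (Polynomial.X + Polynomial.C (n : A))) := by
  have h := RingQuot.mkAlgHom_rel A (URel.yx (A := A) (n := n) (u := u))
  rwa [map_mul, ← Polynomial.aeval_algHom_apply] at h

lemma mul_pow_of_mul_eq_mul_add {B : Type*} [Ring B] [Algebra A B] {b z : B} {c : A}
    (h : b * z = z * (b + algebraMap A B c)) (m : ℕ) :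
    b * z ^ m = z ^ m * (b + algebraMap A B (m * c)) := by
  induction m with
  | zero => simp
  | succ m ih =>
    rw [pow_succ, ← mul_assoc, ih, mul_assoc, add_mul, h, Algebra.commutes, ← mul_add, mul_assoc,
      add_assoc, ← map_add]
    congr 4
    push_cast
    ring

lemma aeval_mul_of_mul_eq_mul_add {B : Type*} [Ring B] [Algebra A B] {b z : B} {c : A}
    (h : b * z = z * (b + algebraMap A B c)) (p : Polynomial A) :
    Polynomial.aeval b p * z =
      z * Polynomial.aeval b (p.comp (Polynomial.X + Polynomial.C c)) := by
  have hpow (k : ℕ) : SemiconjBy z ((b + algebraMap A B c) ^ k) (b ^ k) :=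
    SemiconjBy.pow_right h.symm k
  rw [Polynomial.aeval_comp]
  simp only [map_add, Polynomial.aeval_X, Polynomial.aeval_C]
  induction p using Polynomial.induction_on' with
  | add p q hp hq => simp only [map_add, add_mul, mul_add, hp, hq]
  | monomial k a =>
    rw [Polynomial.aeval_monomial, Polynomial.aeval_monomial, mul_assoc, ← (hpow k).eq,
      ← mul_assoc, ← mul_assoc, Algebra.commutes]

lemma aeval_e_mul_x_pow (m : ℕ) (p : Polynomial A) :
    ∃ q : Polynomial A, Polynomial.aeval (e A n u) p * x A n u ^ m =
      x A n u ^ m * Polynomial.aeval (e A n u) q :=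
  ⟨_, aeval_mul_of_mul_eq_mul_add (mul_pow_of_mul_eq_mul_add (e_mul_x n u) m) p⟩

lemma aeval_e_mul_y_pow (m : ℕ) (p : Polynomial A) :
    ∃ q : Polynomial A, Polynomial.aeval (e A n u) p * y A n u ^ m =
      y A n u ^ m * Polynomial.aeval (e A n u) q :=
  ⟨_, aeval_mul_of_mul_eq_mul_add (mul_pow_of_mul_eq_mul_add (e_mul_y n u) m) p⟩

/-- The family of monomials `ỹ^(l+1) * ẽ^k` and `x̃^m * ẽ^r`. -/
noncomputable abbrev monomials : (ℕ × ℕ) ⊕ (ℕ × ℕ) → UAlg A n u :=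
  Sum.elim
    (fun p : ℕ × ℕ => y A n u ^ (p.2 + 1) * e A n u ^ p.1)
    (fun p : ℕ × ℕ => x A n u ^ p.1 * e A n u ^ p.2)

lemma mul_aeval_mem {B : Type*} [Ring B] [Algebra A B] {S : Submodule A B} {z b : B}
    (h : ∀ k : ℕ, z * b ^ k ∈ S) (p : Polynomial A) : z * Polynomial.aeval b p ∈ S := by
  rw [Polynomial.aeval_eq_sum_range, Finset.mul_sum]
  refine S.sum_mem fun k _ => ?_
  rw [mul_smul_comm]
  exact S.smul_mem _ (h k)

lemma x_pow_mul_aeval_mem (m : ℕ) (p : Polynomial A) :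
    x A n u ^ m * Polynomial.aeval (e A n u) p ∈
      Submodule.span A (Set.range (monomials n u)) :=
  mul_aeval_mem (fun k => Submodule.subset_span (Set.mem_range_self (Sum.inr (m, k)))) p

lemma y_pow_mul_aeval_mem (l : ℕ) (p : Polynomial A) :
    y A n u ^ l * Polynomial.aeval (e A n u) p ∈
      Submodule.span A (Set.range (monomials n u)) := by
  cases l with
  | zero => simpa using x_pow_mul_aeval_mem n u 0 p
  | succ l => exact mul_aeval_mem (fun k => Submodule.subset_span (Set.mem_range_self (Sum.inl (k, l)))) p

lemma mul_mem_span_monomials {g : UAlg A n u}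
    (hx : ∀ (m : ℕ) (p : Polynomial A), g * (x A n u ^ m * Polynomial.aeval (e A n u) p) ∈
      Submodule.span A (Set.range (monomials n u)))
    (hy : ∀ (l : ℕ) (p : Polynomial A), g * (y A n u ^ (l + 1) * Polynomial.aeval (e A n u) p) ∈
      Submodule.span A (Set.range (monomials n u)))
    {s : UAlg A n u} (hs : s ∈ Submodule.span A (Set.range (monomials n u))) :
    g * s ∈ Submodule.span A (Set.range (monomials n u)) := by
  induction hs using Submodule.span_induction with
  | mem s hs =>
    obtain ⟨⟨k, l⟩ | ⟨m, r⟩, rfl⟩ := hs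
    · simpa using hy l (Polynomial.X ^ k)
    · simpa using hx m (Polynomial.X ^ r)
  | zero => simp
  | add s t _ _ hs ht => rw [mul_add]; exact add_mem hs ht
  | smul a s _ hs => rw [mul_smul_comm]; exact Submodule.smul_mem _ a hs

lemma x_mul_mem {s : UAlg A n u} (hs : s ∈ Submodule.span A (Set.range (monomials n u))) :
    x A n u * s ∈ Submodule.span A (Set.range (monomials n u)) := by
  refine mul_mem_span_monomials n u (fun m p => ?_) (fun l p => ?_) hs
  · rw [← mul_assoc, ← pow_succ']
    exact x_pow_mul_aeval_mem n u (m + 1) p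
  · obtain ⟨q, hq⟩ := aeval_e_mul_y_pow n u l u
    rw [pow_succ', ← mul_assoc, ← mul_assoc, x_mul_y, hq, mul_assoc, ← map_mul]
    exact y_pow_mul_aeval_mem n u l _

lemma y_mul_mem {s : UAlg A n u} (hs : s ∈ Submodule.span A (Set.range (monomials n u))) :
    y A n u * s ∈ Submodule.span A (Set.range (monomials n u)) := by
  refine mul_mem_span_monomials n u (fun m p => ?_) (fun l p => ?_) hs
  · cases m with
    | zero => simpa using y_pow_mul_aeval_mem n u 1 p
    | succ m =>
      obtain ⟨q, hq⟩ :=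
        aeval_e_mul_x_pow n u m (u.comp (Polynomial.X + Polynomial.C (n : A)))
      rw [pow_succ', ← mul_assoc, ← mul_assoc, y_mul_x, hq, mul_assoc, ← map_mul]
      exact x_pow_mul_aeval_mem n u m _
  · rw [← mul_assoc, ← pow_succ']
    exact y_pow_mul_aeval_mem n u (l + 1 + 1) p

lemma e_mul_mem {s : UAlg A n u} (hs : s ∈ Submodule.span A (Set.range (monomials n u))) :
    e A n u * s ∈ Submodule.span A (Set.range (monomials n u)) := by
  refine mul_mem_span_monomials n u (fun m p => ?_) (fun l p => ?_) hs
  · obtain ⟨q, hq⟩ := aeval_e_mul_x_pow n u m Polynomial.X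
    rw [Polynomial.aeval_X] at hq
    rw [← mul_assoc, hq, mul_assoc, ← map_mul]
    exact x_pow_mul_aeval_mem n u m _
  · obtain ⟨q, hq⟩ := aeval_e_mul_y_pow n u (l + 1) Polynomial.X
    rw [Polynomial.aeval_X] at hq
    rw [← mul_assoc, hq, mul_assoc, ← map_mul]
    exact y_pow_mul_aeval_mem n u (l + 1) _

lemma span_monomials : Submodule.span A (Set.range (monomials n u)) = ⊤ := by
  have key (a : FreeAlgebra A (Fin 3)) :
      ∀ s ∈ Submodule.span A (Set.range (monomials n u)),
        RingQuot.mkAlgHom A (URel A n u) a * s ∈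
          Submodule.span A (Set.range (monomials n u)) := by
    induction a using FreeAlgebra.induction with
    | grade0 r =>
      intro s hs
      rw [AlgHom.commutes, ← Algebra.smul_def]
      exact Submodule.smul_mem _ r hs
    | grade1 i =>
      intro s hs
      fin_cases i
      · exact x_mul_mem n u hs
      · exact y_mul_mem n u hs
      · exact e_mul_mem n u hs
    | mul a b ha hb =>
      intro s hs
      rw [map_mul, mul_assoc]
      exact ha _ (hb _ hs)
    | add a b ha hb =>
      intro s hs
      rw [map_add, add_mul]
      exact add_mem (ha _ hs) (hb _ hs)
  refine Submodule.eq_top_iff'.mpr fun w => ?_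
  obtain ⟨a, rfl⟩ := RingQuot.mkAlgHom_surjective A (URel A n u) w
  simpa using key a 1 (by simpa using x_pow_mul_aeval_mem n u 0 1)

end Spanning

section Representation

open Polynomial

variable {A : Type*} [CommRing A] (n : ℕ) (u : Polynomial A)

/-- The operator on sequences of polynomials sending `f` to `j ↦ c j * f (j + d)`. -/
noncomputable def weightedShift (c : ℤ → A[X]) (d : ℤ) : Module.End A (ℤ → A[X]) where
  toFun f j := c j * f (j + d)
  map_add' f g := by ext1 j; simp [mul_add]
  map_smul' a f := by ext1 j; simp

@[simp]
lemma weightedShift_apply (c : ℤ → A[X]) (d : ℤ) (f : ℤ → A[X]) (j : ℤ) :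
    weightedShift c d f j = c j * f (j + d) := rfl

/-- The polynomial `u(t + n * j)`. -/
noncomputable def translate (j : ℤ) : A[X] := u.comp (X + C ((n : A) * (j : A)))

/-- The action of `ẽ` on `ℤ → A[X]`. The degree `i` component stands for `x̃^i * A[ẽ]` if `0 ≤ i`
and for `ỹ^(-i) * A[ẽ]` if `i ≤ 0`. -/
noncomputable def opE : Module.End A (ℤ → A[X]) :=
  weightedShift (fun j => X + C ((n : A) * (j : A))) 0

/-- The action of `x̃` on `ℤ → A[X]`. -/
noncomputable def opX : Module.End A (ℤ → A[X]) :=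
  weightedShift (fun j => if 0 < j then 1 else translate n u j) (-1)

/-- The action of `ỹ` on `ℤ → A[X]`. -/
noncomputable def opY : Module.End A (ℤ → A[X]) :=
  weightedShift (fun j => if j < 0 then 1 else translate n u (j + 1)) 1

lemma aeval_opE_apply (p : A[X]) (f : ℤ → A[X]) (j : ℤ) :
    aeval (opE n) p f j = translate n p j * f j := by
  have hpow (k : ℕ) : (opE n ^ k) f j = (X + C ((n : A) * (j : A))) ^ k * f j := by
    induction k with
    | zero => simp
    | succ k ih => rw [pow_succ', Module.End.mul_apply, opE, weightedShift_apply, add_zero, ← opE,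
        ih, pow_succ', mul_assoc]
  induction p using Polynomial.induction_on' with
  | add p q hp hq => simp [translate, add_mul] at hp hq ⊢; rw [hp, hq]
  | monomial k a =>
    rw [aeval_monomial, Module.End.mul_apply, Module.algebraMap_end_apply, Pi.smul_apply, hpow,
      translate, monomial_comp, smul_eq_C_mul, mul_assoc]

lemma opX_mul_opY : opX n u * opY n u = aeval (opE n) u := by
  refine LinearMap.ext fun f => funext fun j => ?_
  rw [aeval_opE_apply, Module.End.mul_apply, opX, opY, weightedShift_apply, weightedShift_apply]
  by_cases h : 0 < j
  · simp [h, show ¬ (j + -1 < 0) by lia]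
  · simp [h, show j + -1 < 0 by lia]

lemma opY_mul_opX : opY n u * opX n u = aeval (opE n) (u.comp (X + C (n : A))) := by
  refine LinearMap.ext fun f => funext fun j => ?_
  have ht : translate n (u.comp (X + C (n : A))) j = translate n u (j + 1) := by
    simp only [translate, comp_assoc, add_comp, X_comp, C_comp, add_assoc, ← C_add]
    congr 3
    push_cast
    ring
  rw [aeval_opE_apply, ht, Module.End.mul_apply, opX, opY, weightedShift_apply,
    weightedShift_apply]
  by_cases h : j < 0
  · simp [h, show ¬ (0 < j + 1) by lia]
  · simp [h, show 0 < j + 1 by lia]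

lemma opE_mul_opX_sub : opE n * opX n u - opX n u * opE n = n • opX n u := by
  refine LinearMap.ext fun f => funext fun j => ?_
  simp [opE, opX]
  split_ifs <;> ring

lemma opE_mul_opY_sub : opE n * opY n u - opY n u * opE n = -(n • opY n u) := by
  refine LinearMap.ext fun f => funext fun j => ?_
  simp [opE, opY]
  split_ifs <;> ring

/-- The representation of the free algebra given by `opX`, `opY` and `opE`. -/
noncomputable def freeRep : FreeAlgebra A (Fin 3) →ₐ[A] Module.End A (ℤ → A[X]) :=
  FreeAlgebra.lift A ![opX n u, opY n u, opE n]

lemma freeRep_gX : freeRep n u (gX A) = opX n u := by simp [freeRep, gX]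

lemma freeRep_gY : freeRep n u (gY A) = opY n u := by simp [freeRep, gY]

lemma freeRep_gE : freeRep n u (gE A) = opE n := by simp [freeRep, gE]

/-- The representation of `U(A,u,n)` on `ℤ → A[X]`. -/
noncomputable def rep : UAlg A n u →ₐ[A] Module.End A (ℤ → A[X]) :=
  RingQuot.liftAlgHom A ⟨freeRep n u, by
    rintro _ _ (_ | _ | _ | _)
    · simp only [map_sub, map_mul, map_nsmul, freeRep_gX, freeRep_gE, opE_mul_opX_sub]
    · simp only [map_sub, map_mul, map_neg, map_nsmul, freeRep_gY, freeRep_gE, opE_mul_opY_sub]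
    · rw [map_mul, ← aeval_algHom_apply, freeRep_gX, freeRep_gY, freeRep_gE, opX_mul_opY]
    · rw [map_mul, ← aeval_algHom_apply, freeRep_gX, freeRep_gY, freeRep_gE, opY_mul_opX]⟩

lemma rep_x : rep n u (x A n u) = opX n u := by
  rw [rep, x, RingQuot.liftAlgHom_mkAlgHom_apply, freeRep_gX]

lemma rep_y : rep n u (y A n u) = opY n u := by
  rw [rep, y, RingQuot.liftAlgHom_mkAlgHom_apply, freeRep_gY]

lemma rep_e : rep n u (e A n u) = opE n := by
  rw [rep, e, RingQuot.liftAlgHom_mkAlgHom_apply, freeRep_gE]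

lemma opE_pow_single (k : ℕ) :
    (opE n ^ k) (Pi.single 0 1) = (Pi.single 0 (X ^ k) : ℤ → A[X]) := by
  have h := aeval_opE_apply n (X ^ k : A[X]) (Pi.single 0 1)
  ext1 j
  rw [map_pow, aeval_X] at h
  rw [h]
  rcases eq_or_ne j 0 with rfl | hj
  · simp [translate]
  · simp [hj]

lemma opX_pow_single (m : ℕ) (p : A[X]) :
    (opX n u ^ m) (Pi.single 0 p) = Pi.single (m : ℤ) p := by
  induction m with
  | zero => simp
  | succ m ih =>
    rw [pow_succ', Module.End.mul_apply, ih]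
    ext1 j
    rw [opX, weightedShift_apply]
    rcases eq_or_ne j (m + 1) with rfl | hj
    · simp [show (0 : ℤ) < m + 1 by lia]
    · simp [hj, show j + -1 ≠ m by lia]

lemma opY_pow_single (l : ℕ) (p : A[X]) :
    (opY n u ^ l) (Pi.single 0 p) = Pi.single (-(l : ℤ)) p := by
  induction l with
  | zero => simp
  | succ l ih =>
    rw [pow_succ', Module.End.mul_apply, ih]
    ext1 j
    rw [opY, weightedShift_apply]
    rcases eq_or_ne j (-((l + 1 : ℕ) : ℤ)) with rfl | hj
    · simp [show (-1 : ℤ) < l by lia]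
    · rw [Pi.single_eq_of_ne hj, Pi.single_eq_of_ne (by lia), mul_zero]

/-- The degree in `ℤ` and the exponent of `ẽ` of a monomial of the family `monomials`. -/
def bidegree : (ℕ × ℕ) ⊕ (ℕ × ℕ) → (_ : ℤ) × ℕ :=
  Sum.elim (fun p => ⟨-((p.2 + 1 : ℕ) : ℤ), p.1⟩) (fun p => ⟨(p.1 : ℤ), p.2⟩)

lemma bidegree_injective : Function.Injective bidegree := by
  rintro (⟨a, b⟩ | ⟨a, b⟩) (⟨c, d⟩ | ⟨c, d⟩) h <;> simp [bidegree] at h ⊢ <;> lia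

lemma linearIndependent_monomials : LinearIndependent A (monomials n u) := by
  let φ : UAlg A n u →ₗ[A] (ℤ → A[X]) :=
    (LinearMap.applyₗ (Pi.single 0 1 : ℤ → A[X])).comp (rep n u).toLinearMap
  have hsingle : LinearIndependent A
      (fun i : (_ : ℤ) × ℕ => (Pi.single i.1 (X ^ i.2) : ℤ → A[X])) := by
    have hX : LinearIndependent A (fun k : ℕ => (X ^ k : A[X])) := by
      simpa [coe_basisMonomials, monomial_one_right_eq_X_pow] using
        (basisMonomials A).linearIndependent
    exact Pi.linearIndependent_single (fun _ k => (X ^ k : A[X])) fun _ => hX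
  refine LinearIndependent.of_comp φ ?_
  convert hsingle.comp bidegree bidegree_injective using 1
  ext1 i
  rcases i with ⟨k, l⟩ | ⟨m, r⟩
  · simp [φ, bidegree, rep_y, rep_e, opE_pow_single, opY_pow_single]
  · simp [φ, bidegree, rep_x, rep_e, opE_pow_single, opX_pow_single]

end Representation

/-- The family consisting of the elements `ỹ^ℓ·ẽ^k` (`ℓ ≥ 1`, `k ≥ 0`)
together with the elements `x̃^m·ẽ^r` (`m, r ≥ 0`) is an `A`-module basis of `U(A,u,n)`:
it is `A`-linearly independent and spans `U(A,u,n)` over `A`.  (The first summand of the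
index type parametrizes the pairs `(k, ℓ)` with `ℓ ≥ 1` via `ℓ = l + 1`.) -/
theorem stmt_8 {A : Type*} [CommRing A] [IsDomain A] [Algebra ℂ A]
    (n : ℕ) (hn : 0 < n) (u : Polynomial A) :
    LinearIndependent A
      (Sum.elim
        (fun p : ℕ × ℕ => y A n u ^ (p.2 + 1) * e A n u ^ p.1)
        (fun p : ℕ × ℕ => x A n u ^ p.1 * e A n u ^ p.2)) ∧
    Submodule.span A
      (Set.range
        (Sum.elim
          (fun p : ℕ × ℕ => y A n u ^ (p.2 + 1) * e A n u ^ p.1)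
          (fun p : ℕ × ℕ => x A n u ^ p.1 * e A n u ^ p.2))) = ⊤ := by
  exact ⟨linearIndependent_monomials n u, span_monomials n u⟩

end UAlgebraStmt
end

section
/- There is an associative unital ℂ-algebra structure on the ℂ-vector space ℂ[t,t⁻¹] ⊗_ℂ ℂ[X₀,X₁,…,X_r] whose multiplication satisfies (t^m ⊗ P)·(t^ℓ ⊗ Q) = t^{m+ℓ} ⊗ (τ_ℓ P)·Q for all m, ℓ ∈ ℤ and all P, Q ∈ ℂ[X₀,…,X_r], where (τ_ℓ P)(X₀,X₁,…,X_r) = P(X₀+ℓ, X₁,…,X_r); and with this multiplication, the ℂ-linear map ν determined by ν(t^m ⊗ X₀^{α₀} X₁^{α₁}⋯X_r^{α_r}) = (T^m ∘ D^{α₀}) ⊗ (X₁^{α₁}⋯X_r^{α_r}) is an isomorphism of ℂ-algebras onto 𝒲 ⊗_ℂ ℂ[X₁,…,X_r], where 𝒲 (the Weyl algebra of the one-dimensional torus ℂ[t,t⁻¹,t·d/dt]) is the ℂ-subalgebra of the ℂ-linear endomorphisms of ℂ[t,t⁻¹] generated by multiplication by t, multiplication by t⁻¹, and D. -/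
open scoped TensorProduct

set_option synthInstance.maxHeartbeats 1000000
set_option maxHeartbeats 1000000

namespace TorusWeyl

open LaurentPolynomial

/-- The subalgebra of `End ℂ[t,t⁻¹]` generated by multiplication by `t^{±1}` and by `D`. -/
noncomputable abbrev weylAlgebra (D : Module.End ℂ (LaurentPolynomial ℂ)) :
    Subalgebra ℂ (Module.End ℂ (LaurentPolynomial ℂ)) :=
  Algebra.adjoin ℂ
    {LinearMap.mulLeft ℂ (LaurentPolynomial.T 1),
     LinearMap.mulLeft ℂ (LaurentPolynomial.T (-1)), D}

variable (D : Module.End ℂ (LaurentPolynomial ℂ))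

lemma mulLeft_T_mem (m : ℤ) :
    LinearMap.mulLeft ℂ (T m : LaurentPolynomial ℂ) ∈ weylAlgebra D := by
  have hpos : LinearMap.mulLeft ℂ (T 1 : LaurentPolynomial ℂ) ∈ weylAlgebra D :=
    Algebra.subset_adjoin (by simp)
  have hneg : LinearMap.mulLeft ℂ (T (-1) : LaurentPolynomial ℂ) ∈ weylAlgebra D :=
    Algebra.subset_adjoin (by simp)
  induction m with
  | zero => simp [one_mem, LinearMap.mulLeft_one, ← Module.End.one_eq_id]
  | succ n ih =>
    rw [T_add, LinearMap.mulLeft_mul]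
    exact mul_mem ih hpos
  | pred n ih =>
    rw [sub_eq_add_neg, T_add, LinearMap.mulLeft_mul]
    exact mul_mem ih hneg

lemma mulLeft_mem (f : LaurentPolynomial ℂ) : LinearMap.mulLeft ℂ f ∈ weylAlgebra D := by
  induction f using LaurentPolynomial.induction_on' with
  | add p q hp hq =>
    have h : LinearMap.mulLeft ℂ (p + q) = LinearMap.mulLeft ℂ p + LinearMap.mulLeft ℂ q := by
      ext; simp [add_mul]
    rw [h]
    exact add_mem hp hq
  | C_mul_T n a =>
    have h : LinearMap.mulLeft ℂ (a • T n : LaurentPolynomial ℂ) =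
        a • LinearMap.mulLeft ℂ (T n) :=
      LinearMap.ext fun x => smul_mul_assoc a (T n) x
    rw [← smul_eq_C_mul, h]
    exact Subalgebra.smul_mem _ (mulLeft_T_mem D n) a

/-- Multiplication operators, as elements of the Weyl algebra. -/
noncomputable def mulHom : LaurentPolynomial ℂ →ₐ[ℂ] weylAlgebra D :=
  (Algebra.lmul ℂ (LaurentPolynomial ℂ)).codRestrict _ (mulLeft_mem D)

/-- The operator `D`, as an element of the Weyl algebra. -/
def euler : weylAlgebra D := ⟨D, Algebra.subset_adjoin (by simp)⟩

lemma coe_mulHom (f : LaurentPolynomial ℂ) :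
    (mulHom D f : Module.End ℂ (LaurentPolynomial ℂ)) = LinearMap.mulLeft ℂ f := rfl

lemma coe_euler : (euler D : Module.End ℂ (LaurentPolynomial ℂ)) = D := rfl

/-- The map `f ⊗ p ↦ f · p(D)`. -/
noncomputable def normalForm :
    LaurentPolynomial ℂ ⊗[ℂ] Polynomial ℂ →ₗ[ℂ] weylAlgebra D :=
  TensorProduct.lift ((LinearMap.mul ℂ (weylAlgebra D)).compl₁₂
    (mulHom D).toLinearMap (Polynomial.aeval (euler D)).toLinearMap)

lemma normalForm_tmul (f : LaurentPolynomial ℂ) (p : Polynomial ℂ) :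
    normalForm D (f ⊗ₜ p) = mulHom D f * Polynomial.aeval (euler D) p := by
  simp [normalForm]

variable {D}

section

variable (hD : ∀ k : ℤ, D (LaurentPolynomial.T k) = (k : ℂ) • LaurentPolynomial.T k)
include hD

lemma aeval_euler_apply_T (p : Polynomial ℂ) (k : ℤ) :
    (Polynomial.aeval (euler D) p : Module.End ℂ (LaurentPolynomial ℂ)) (T k) =
      p.eval (k : ℂ) • T k := by
  induction p using Polynomial.induction_on' with
  | add p q hp hq => simp [hp, hq, add_smul]
  | monomial n a =>
    have h : (D ^ n) (T k) = (k : ℂ) ^ n • T k := by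
      induction n with
      | zero => simp
      | succ n ih => rw [pow_succ', Module.End.mul_apply, ih, map_smul, hD, smul_smul, pow_succ]
    simp [Polynomial.aeval_monomial, coe_euler, h, smul_smul, Module.algebraMap_end_apply, mul_comm]

lemma coeff_normalForm_apply_T (z : LaurentPolynomial ℂ ⊗[ℂ] Polynomial ℂ) (m k : ℤ) :
    ((normalForm D z : Module.End ℂ (LaurentPolynomial ℂ)) (T k)).coeff (m + k) =
      (TensorProduct.equivFinsuppOfBasisLeft (AddMonoidAlgebra.basis ℤ ℂ) z m).eval (k : ℂ) := by
  induction z with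
  | zero => simp
  | add x y hx hy => simp [hx, hy]
  | tmul f p =>
    rw [TensorProduct.equivFinsuppOfBasisLeft_apply_tmul_apply, normalForm_tmul,
      Subalgebra.coe_mul, Module.End.mul_apply, aeval_euler_apply_T hD, coe_mulHom,
      LinearMap.mulLeft_apply]
    rw [mul_smul_comm, AddMonoidAlgebra.coeff_smul, Finsupp.smul_apply, T,
      AddMonoidAlgebra.coeff_mul_single_add, Polynomial.eval_smul, smul_eq_mul, smul_eq_mul,
      mul_one, mul_comm]
    rfl

lemma normalForm_injective : Function.Injective (normalForm D) := by
  rw [injective_iff_map_eq_zero]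
  intro z hz
  apply (TensorProduct.equivFinsuppOfBasisLeft (N := Polynomial ℂ)
    (AddMonoidAlgebra.basis ℤ ℂ)).injective
  rw [map_zero]
  ext1 m
  refine Polynomial.eq_zero_of_infinite_isRoot _
    ((Set.infinite_range_of_injective (Int.cast_injective (α := ℂ))).mono ?_)
  rintro _ ⟨k, rfl⟩
  have := coeff_normalForm_apply_T hD z m k
  rw [hz] at this
  simpa using this.symm

lemma euler_mul_mulHom_T (l : ℤ) :
    euler D * mulHom D (T l) = mulHom D (T l) * (euler D + algebraMap ℂ _ (l : ℂ)) := by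
  apply Subtype.ext
  refine (AddMonoidAlgebra.basis ℤ ℂ).ext fun k => ?_
  rw [AddMonoidAlgebra.basis_apply]
  change D (T l * T k) = T l * (D (T k) + (l : ℂ) • T k)
  rw [hD, ← T_add, hD, ← add_smul, mul_smul_comm, ← T_add]
  push_cast
  rw [add_comm]

lemma aeval_euler_mul_mulHom_T (p : Polynomial ℂ) (l : ℤ) :
    Polynomial.aeval (euler D) p * mulHom D (T l) = mulHom D (T l) *
      Polynomial.aeval (euler D) (p.comp (Polynomial.X + Polynomial.C (l : ℂ))) := by
  have h : SemiconjBy (mulHom D (T l)) (euler D + algebraMap ℂ _ (l : ℂ)) (euler D) :=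
    (euler_mul_mulHom_T hD l).symm
  rw [Polynomial.aeval_comp, map_add, Polynomial.aeval_X, Polynomial.aeval_C]
  induction p using Polynomial.induction_on' with
  | add p q hp hq => simp only [map_add, add_mul, mul_add, hp, hq]
  | monomial n a =>
    simp only [Polynomial.aeval_monomial]
    rw [mul_assoc, ← (h.pow_right n).eq, ← mul_assoc, Algebra.commutes, mul_assoc]

lemma normalForm_surjective : Function.Surjective (normalForm D) := by
  have hmul : ∀ z w, normalForm D z * normalForm D w ∈ LinearMap.range (normalForm D) := by
    intro z w
    induction z with
    | zero => simp
    | add x y hx hy => rw [map_add, add_mul]; exact add_mem hx hy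
    | tmul f p =>
      induction w with
      | zero => simp
      | add x y hx hy => rw [map_add, mul_add]; exact add_mem hx hy
      | tmul g q =>
        induction g using LaurentPolynomial.induction_on' with
        | add g₁ g₂ h₁ h₂ =>
          rw [TensorProduct.add_tmul, map_add, mul_add]; exact add_mem h₁ h₂
        | C_mul_T l a =>
          refine ⟨a • ((f * T l) ⊗ₜ
            (p.comp (Polynomial.X + Polynomial.C (l : ℂ)) * q)), ?_⟩
          rw [← smul_eq_C_mul, ← TensorProduct.smul_tmul', map_smul, map_smul, mul_smul_comm,
            normalForm_tmul, normalForm_tmul, normalForm_tmul, map_mul, map_mul, mul_assoc,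
            mul_assoc, ← mul_assoc (Polynomial.aeval (euler D) p),
            aeval_euler_mul_mulHom_T hD, mul_assoc]
  have hmulHom : ∀ f, mulHom D f ∈ LinearMap.range (normalForm D) := fun f =>
    ⟨f ⊗ₜ 1, by simp [normalForm_tmul]⟩
  rintro ⟨w, hw⟩
  change ⟨w, hw⟩ ∈ LinearMap.range (normalForm D)
  induction hw using Algebra.adjoin_induction with
  | mem x hx =>
    rcases hx with rfl | rfl | rfl
    · exact hmulHom (T 1)
    · exact hmulHom (T (-1))
    · exact ⟨1 ⊗ₜ Polynomial.X, by simp [normalForm_tmul]; rfl⟩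
  | algebraMap a =>
    have h : mulHom D (algebraMap ℂ _ a) ∈ LinearMap.range (normalForm D) := hmulHom _
    rwa [AlgHom.commutes] at h
  | add x y _ _ hx hy => exact add_mem hx hy
  | mul x y _ _ hx hy =>
    obtain ⟨z, hz⟩ := hx
    obtain ⟨w, hw⟩ := hy
    have h := hmul z w
    rwa [hz, hw] at h

lemma normalForm_bijective : Function.Bijective (normalForm D) :=
  ⟨normalForm_injective hD, normalForm_surjective hD⟩

end

/-- Splitting off the variable `X₀`. -/
noncomputable def splitEquiv (r : ℕ) :
    MvPolynomial (Fin (r + 1)) ℂ ≃ₐ[ℂ] Polynomial ℂ ⊗[ℂ] MvPolynomial (Fin r) ℂ :=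
  ((MvPolynomial.finSuccEquiv ℂ r).trans (polyEquivTensor ℂ (MvPolynomial (Fin r) ℂ))).trans
    (Algebra.TensorProduct.comm ℂ _ _)

lemma splitEquiv_X_zero (r : ℕ) :
    splitEquiv r (MvPolynomial.X 0) = Polynomial.X ⊗ₜ 1 := by
  simp [splitEquiv, polyEquivTensor_apply, MvPolynomial.finSuccEquiv_X_zero]

lemma splitEquiv_X_succ (r : ℕ) (i : Fin r) :
    splitEquiv r (MvPolynomial.X i.succ) = 1 ⊗ₜ MvPolynomial.X i := by
  simp [splitEquiv, polyEquivTensor_apply, MvPolynomial.finSuccEquiv_X_succ]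

variable (D) in
/-- The algebra map sending `X₀` to `D ⊗ 1` and `Xᵢ` to `1 ⊗ Xᵢ` for `i ≥ 1`. -/
noncomputable def evalHom (r : ℕ) :
    MvPolynomial (Fin (r + 1)) ℂ →ₐ[ℂ] weylAlgebra D ⊗[ℂ] MvPolynomial (Fin r) ℂ :=
  (Algebra.TensorProduct.map (Polynomial.aeval (euler D)) (AlgHom.id ℂ _)).comp
    (splitEquiv r).toAlgHom

lemma evalHom_X_zero (r : ℕ) : evalHom D r (MvPolynomial.X 0) = euler D ⊗ₜ 1 := by
  simp [evalHom, splitEquiv_X_zero]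

lemma evalHom_X_succ (r : ℕ) (i : Fin r) :
    evalHom D r (MvPolynomial.X i.succ) = 1 ⊗ₜ MvPolynomial.X i := by
  simp [evalHom, splitEquiv_X_succ]

lemma evalHom_prod (r : ℕ) (α : Fin (r + 1) → ℕ) :
    evalHom D r (∏ i, MvPolynomial.X i ^ α i) =
      (euler D ^ α 0) ⊗ₜ ∏ i : Fin r, MvPolynomial.X i ^ α i.succ := by
  have h : (∏ i : Fin r, (MvPolynomial.X i.succ ^ α i.succ : MvPolynomial (Fin (r + 1)) ℂ)) =
      MvPolynomial.rename Fin.succ (∏ i : Fin r, MvPolynomial.X i ^ α i.succ) := by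
    simp [map_prod]
  have h' : (evalHom D r).comp (MvPolynomial.rename Fin.succ) =
      Algebra.TensorProduct.includeRight := by
    ext i
    simp [evalHom_X_succ]
  rw [Fin.prod_univ_succ, h, map_mul, map_pow, evalHom_X_zero, ← AlgHom.comp_apply, h']
  simp [Algebra.TensorProduct.tmul_pow]

lemma evalHom_mul_mulHom_T
    (hD : ∀ k : ℤ, D (LaurentPolynomial.T k) = (k : ℂ) • LaurentPolynomial.T k)
    (r : ℕ) (l : ℤ) (P : MvPolynomial (Fin (r + 1)) ℂ) :
    evalHom D r P * (mulHom D (T l) ⊗ₜ 1) = (mulHom D (T l) ⊗ₜ 1) *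
      evalHom D r ((MvPolynomial.aeval fun i : Fin (r + 1) =>
                if i = 0 then MvPolynomial.X 0 + MvPolynomial.C (l : ℂ)
                else MvPolynomial.X i) P) := by
  induction P using MvPolynomial.induction_on with
  | C a =>
    rw [MvPolynomial.aeval_C, ← MvPolynomial.algebraMap_eq, AlgHom.commutes,
      Algebra.commutes]
  | add p q hp hq => simp only [map_add, add_mul, mul_add, hp, hq]
  | mul_X p i hp =>
    have hX : evalHom D r (MvPolynomial.X i) * (mulHom D (T l) ⊗ₜ 1) =
        (mulHom D (T l) ⊗ₜ 1) * evalHom D r (if i = 0 then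
          MvPolynomial.X 0 + MvPolynomial.C (l : ℂ) else MvPolynomial.X i) := by
      refine Fin.cases ?_ (fun j => ?_) i
      · rw [if_pos rfl, map_add, evalHom_X_zero, ← MvPolynomial.algebraMap_eq, AlgHom.commutes,
          Algebra.TensorProduct.algebraMap_apply, ← TensorProduct.add_tmul,
          Algebra.TensorProduct.tmul_mul_tmul, Algebra.TensorProduct.tmul_mul_tmul,
          euler_mul_mulHom_T hD]
      · rw [if_neg (Fin.succ_ne_zero j), evalHom_X_succ]
        simp
    rw [map_mul, map_mul, map_mul, MvPolynomial.aeval_X, mul_assoc, hX, ← mul_assoc, hp,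
      mul_assoc]

/-- The linear bijection `f ⊗ P ↦ (f ⊗ 1) · P(D ⊗ 1, 1 ⊗ X₁, …, 1 ⊗ X_r)`. -/
noncomputable def torusEquiv
    (hD : ∀ k : ℤ, D (LaurentPolynomial.T k) = (k : ℂ) • LaurentPolynomial.T k) (r : ℕ) :
    LaurentPolynomial ℂ ⊗[ℂ] MvPolynomial (Fin (r + 1)) ℂ ≃ₗ[ℂ]
      weylAlgebra D ⊗[ℂ] MvPolynomial (Fin r) ℂ :=
  (TensorProduct.congr (LinearEquiv.refl ℂ _) (splitEquiv r).toLinearEquiv).trans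
    ((TensorProduct.assoc ℂ _ _ _).symm.trans
      (TensorProduct.congr (LinearEquiv.ofBijective (normalForm D)
        (normalForm_bijective hD)) (LinearEquiv.refl ℂ _)))

lemma torusEquiv_tmul
    (hD : ∀ k : ℤ, D (LaurentPolynomial.T k) = (k : ℂ) • LaurentPolynomial.T k) (r : ℕ)
    (f : LaurentPolynomial ℂ) (P : MvPolynomial (Fin (r + 1)) ℂ) :
    torusEquiv hD r (f ⊗ₜ P) = (mulHom D f ⊗ₜ 1) * evalHom D r P := by
  simp only [torusEquiv, evalHom, LinearEquiv.trans_apply, TensorProduct.congr_tmul,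
    AlgHom.comp_apply, LinearEquiv.refl_apply]
  change _ = _ * Algebra.TensorProduct.map _ _ (splitEquiv r P)
  change TensorProduct.congr _ _ ((TensorProduct.assoc ℂ _ _ _).symm (f ⊗ₜ splitEquiv r P)) = _
  induction splitEquiv r P with
  | zero => simp
  | add x y hx hy => simp only [TensorProduct.tmul_add, map_add, mul_add, hx, hy]
  | tmul p q =>
    rw [TensorProduct.assoc_symm_tmul, TensorProduct.congr_tmul, LinearEquiv.ofBijective_apply,
      normalForm_tmul]
    simp

end TorusWeyl

/-- Let `𝒲 ⊆ End_ℂ(ℂ[t,t⁻¹])` be the subalgebra generated by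
multiplication by `t`, multiplication by `t⁻¹` and `D = t·d/dt` (the Weyl algebra of
the one-dimensional torus).  There is a `ℂ`-linear bijection
`ν : ℂ[t,t⁻¹] ⊗ ℂ[X₀,…,X_r] → 𝒲 ⊗ ℂ[X₁,…,X_r]` with
`ν(t^m ⊗ X₀^{α₀}⋯X_r^{α_r}) = (T^m ∘ D^{α₀}) ⊗ X₁^{α₁}⋯X_r^{α_r}`, which transports
the multiplication `(t^m ⊗ P)·(t^ℓ ⊗ Q) = t^{m+ℓ} ⊗ (τ_ℓ P)·Q` (where
`(τ_ℓ P)(X₀,…) = P(X₀+ℓ,…)`) to the tensor-product algebra structure of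
`𝒲 ⊗ ℂ[X₁,…,X_r]`: it is an isomorphism of `ℂ`-algebras for this multiplication. -/
theorem stmt_10 (r : ℕ) (D : Module.End ℂ (LaurentPolynomial ℂ))
    (hD : ∀ k : ℤ, D (LaurentPolynomial.T k) = (k : ℂ) • LaurentPolynomial.T k) :
    ∃ ν : (LaurentPolynomial ℂ ⊗[ℂ] MvPolynomial (Fin (r + 1)) ℂ) ≃ₗ[ℂ]
        ((Algebra.adjoin ℂ
            {LinearMap.mulLeft ℂ (LaurentPolynomial.T 1),
             LinearMap.mulLeft ℂ (LaurentPolynomial.T (-1)), D} :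
          Subalgebra ℂ (Module.End ℂ (LaurentPolynomial ℂ))) ⊗[ℂ]
          MvPolynomial (Fin r) ℂ),
      (∀ (m : ℤ) (α : Fin (r + 1) → ℕ),
        ∃ h : LinearMap.mulLeft ℂ (LaurentPolynomial.T m) * D ^ (α 0) ∈
            Algebra.adjoin ℂ
              {LinearMap.mulLeft ℂ (LaurentPolynomial.T 1),
               LinearMap.mulLeft ℂ (LaurentPolynomial.T (-1)), D},
          ν (LaurentPolynomial.T m ⊗ₜ[ℂ] ∏ i, MvPolynomial.X i ^ α i) =
            (⟨LinearMap.mulLeft ℂ (LaurentPolynomial.T m) * D ^ (α 0), h⟩ ⊗ₜ[ℂ]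
              ∏ i : Fin r, MvPolynomial.X i ^ α i.succ)) ∧
      (∀ (m l : ℤ) (P Q : MvPolynomial (Fin (r + 1)) ℂ),
        ν (LaurentPolynomial.T m ⊗ₜ[ℂ] P) * ν (LaurentPolynomial.T l ⊗ₜ[ℂ] Q) =
          ν (LaurentPolynomial.T (m + l) ⊗ₜ[ℂ]
            ((MvPolynomial.aeval fun i : Fin (r + 1) =>
                if i = 0 then MvPolynomial.X 0 + MvPolynomial.C (l : ℂ)
                else MvPolynomial.X i) P * Q))) := by
  refine ⟨TorusWeyl.torusEquiv hD r, fun m α => ⟨?_, ?_⟩, fun m l P Q => ?_⟩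
  · exact mul_mem (TorusWeyl.mulLeft_T_mem D m) (pow_mem (Algebra.subset_adjoin (by simp)) _)
  · rw [TorusWeyl.torusEquiv_tmul, TorusWeyl.evalHom_prod,
      Algebra.TensorProduct.tmul_mul_tmul, one_mul]
    rfl
  · rw [TorusWeyl.torusEquiv_tmul, TorusWeyl.torusEquiv_tmul, TorusWeyl.torusEquiv_tmul, map_mul,
      LaurentPolynomial.T_add, map_mul, mul_assoc, ← mul_assoc (TorusWeyl.evalHom D r P),
      TorusWeyl.evalHom_mul_mulHom_T hD, ← mul_assoc, ← mul_assoc, ← mul_assoc,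
      Algebra.TensorProduct.tmul_mul_tmul, one_mul]
end

section
/- Every two-sided ideal J of R is a graded ideal: for every element a ∈ J, each homogeneous component of a (each component a_i ∈ R_i of the decomposition a = Σ_i a_i) belongs to J. -/
namespace GradedStmt

/-- `J` is a two-sided ideal of the ring `R`: it contains `0`, is closed under
addition and negation, and is closed under left and right multiplication by
arbitrary elements of `R`. -/
def IsTwoSidedIdeal {R : Type*} [Ring R] (J : Set R) : Prop :=
  (0 : R) ∈ J ∧ (∀ a ∈ J, ∀ b ∈ J, a + b ∈ J) ∧ (∀ a ∈ J, -a ∈ J) ∧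
    ∀ r : R, ∀ a ∈ J, r * a ∈ J ∧ a * r ∈ J

/-- If a finite sum of eigenvectors of `D` with pairwise distinct eigenvalues lies in a
`D`-invariant subspace, then so does each summand. -/
theorem mem_of_sum_eigenvectors_mem {ι K V : Type*} [Field K] [AddCommGroup V] [Module K V]
    (D : V →ₗ[K] V) (N : Submodule K V) (hN : ∀ x ∈ N, D x ∈ N)
    (c : ι → K) (hc : Function.Injective c) (s : Finset ι) (f : ι → V)
    (hf : ∀ i, D (f i) = c i • f i) (hs : ∑ i ∈ s, f i ∈ N) :
    ∀ i ∈ s, f i ∈ N := by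
  classical
  induction s using Finset.induction_on generalizing f with
  | empty => simp
  | insert j s hj ih =>
    have hdiff : ∑ i ∈ s, (c i - c j) • f i ∈ N := by
      have h := N.sub_mem (hN _ hs) (N.smul_mem (c j) hs)
      simpa [Finset.sum_insert hj, hf, Finset.smul_sum, sub_smul] using h
    have hmem : ∀ i ∈ s, f i ∈ N := by
      intro i hi
      have hne : c i - c j ≠ 0 := sub_ne_zero.mpr fun h => hj (hc h ▸ hi)
      refine (N.smul_mem_iff hne).mp (ih (fun i => (c i - c j) • f i) ?_ hdiff i hi)
      intro k
      rw [map_smul, hf, smul_comm]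
    intro i hi
    rcases Finset.mem_insert.mp hi with rfl | hi
    · rw [Finset.sum_insert hj] at hs
      exact (N.add_mem_iff_left (N.sum_mem hmem)).mp hs
    · exact hmem i hi

/-- Let `R = ⊕_{i∈ℤ} R_i` be a ℤ-graded associative unital
`ℂ`-algebra, `d₀` a nonzero integer and `E ∈ R₀` with `E·a − a·E = d₀·i·a` for all
`a ∈ R_i`.  Then every two-sided ideal `J` of `R` is graded: for every `a ∈ J`,
each homogeneous component of `a` belongs to `J`. -/
theorem stmt_11 {R : Type*} [Ring R] [Algebra ℂ R]
    (𝒜 : ℤ → Submodule ℂ R) [GradedRing 𝒜]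
    (d₀ : ℤ) (hd₀ : d₀ ≠ 0) (E : R) (hE : E ∈ 𝒜 0)
    (hcomm : ∀ i : ℤ, ∀ a ∈ 𝒜 i, E * a - a * E = (d₀ * i) • a)
    (J : Set R) (hJ : IsTwoSidedIdeal J) :
    ∀ a ∈ J, ∀ i : ℤ, (DirectSum.decompose 𝒜 a i : R) ∈ J := by
  obtain ⟨hzero, hadd, -, hmul⟩ := hJ
  intro a ha i
  let N : Submodule ℂ R :=
    { carrier := J
      zero_mem' := hzero
      add_mem' := fun hx hy => hadd _ hx _ hy
      smul_mem' := fun c x hx => by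
        rw [Algebra.smul_def]
        exact (hmul _ x hx).1 }
  let D : R →ₗ[ℂ] R := LinearMap.mulLeft ℂ E - LinearMap.mulRight ℂ E
  have hD : ∀ x ∈ N, D x ∈ N := fun x hx => N.sub_mem (hmul E x hx).1 (hmul E x hx).2
  have hc : Function.Injective fun k : ℤ => ((d₀ * k : ℤ) : ℂ) :=
    fun k l h => mul_left_cancel₀ hd₀ (Int.cast_injective h)
  have hf : ∀ k, D (DirectSum.decompose 𝒜 a k : R) =
      ((d₀ * k : ℤ) : ℂ) • (DirectSum.decompose 𝒜 a k : R) := by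
    intro k
    rw [Int.cast_smul_eq_zsmul]
    exact hcomm k _ (DirectSum.decompose 𝒜 a k).2
  classical
  by_cases hi : i ∈ (DirectSum.decompose 𝒜 a).support
  · refine mem_of_sum_eigenvectors_mem D N hD _ hc _
      (fun k => (DirectSum.decompose 𝒜 a k : R)) hf ?_ i hi
    rw [DirectSum.sum_support_decompose]
    exact ha
  · rw [DFinsupp.notMem_support_iff.mp hi]
    exact hzero

end GradedStmt
end

section
/- Assume moreover that R₀ is commutative and that there is an element X ∈ R₁ which is invertible in R with X⁻¹ ∈ R₋₁. Then a subset J ⊆ R is a two-sided ideal of R if and only if there exists an ideal J₀ of R₀ with X·J₀·X⁻¹ = J₀ such that J = ⊕_{i∈ℤ} X^i·J₀ (where for i < 0, X^i means (X⁻¹)^{−i}); in that case J₀ = J ∩ R₀ and also J = ⊕_{i∈ℤ} J₀·X^i. -/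
namespace GradedStmt12

/-- `J` is a two-sided ideal of the ring `R`. -/
def IsTwoSidedIdeal {R : Type*} [Ring R] (J : Set R) : Prop :=
  (0 : R) ∈ J ∧ (∀ a ∈ J, ∀ b ∈ J, a + b ∈ J) ∧ (∀ a ∈ J, -a ∈ J) ∧
    ∀ r : R, ∀ a ∈ J, r * a ∈ J ∧ a * r ∈ J

/-- The integer powers `X^i` of an invertible element `X` with chosen inverse `X'`:
for `i ≥ 0` this is `X^i`, for `i < 0` it is `(X')^(−i)`. -/
noncomputable def zpow' {R : Type*} [Ring R] (X X' : R) (i : ℤ) : R :=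
  if 0 ≤ i then X ^ i.toNat else X' ^ (-i).toNat

/-- `J₀` is an ideal of the degree-zero part `R₀ = 𝒜 0`: it is a subset of `𝒜 0`
containing `0`, closed under addition and negation, and closed under multiplication
by elements of `𝒜 0`. -/
def IsIdealOfDegZero {R : Type*} [Ring R] [Algebra ℂ R]
    (𝒜 : ℤ → Submodule ℂ R) (J₀ : Set R) : Prop :=
  J₀ ⊆ (𝒜 0 : Set R) ∧ (0 : R) ∈ J₀ ∧ (∀ a ∈ J₀, ∀ b ∈ J₀, a + b ∈ J₀) ∧
    (∀ a ∈ J₀, -a ∈ J₀) ∧ ∀ r ∈ (𝒜 0 : Set R), ∀ a ∈ J₀, r * a ∈ J₀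

lemma zpow'_eq_units_zpow {R : Type*} [Ring R] (u : Rˣ) (i : ℤ) :
    zpow' (u : R) (↑u⁻¹ : R) i = ((u ^ i : Rˣ) : R) := by
  unfold zpow'
  split_ifs with h
  · obtain ⟨n, rfl⟩ := Int.eq_ofNat_of_zero_le h
    simp
  · obtain ⟨n, hn⟩ := Int.eq_ofNat_of_zero_le (a := -i) (by omega)
    obtain rfl : i = -(n : ℤ) := by omega
    simp

lemma units_zpow_mem {R : Type*} [Ring R] [Algebra ℂ R]
    (𝒜 : ℤ → Submodule ℂ R) [GradedRing 𝒜] (u : Rˣ) (hu : (u : R) ∈ 𝒜 1)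
    (hu' : (↑u⁻¹ : R) ∈ 𝒜 (-1)) (i : ℤ) : ((u ^ i : Rˣ) : R) ∈ 𝒜 i := by
  induction i with
  | zero => simpa using SetLike.GradedOne.one_mem (A := 𝒜)
  | succ n ih =>
    rw [zpow_add_one, Units.val_mul]
    exact SetLike.mul_mem_graded ih hu
  | pred n ih =>
    rw [zpow_sub_one, Units.val_mul]
    exact SetLike.mul_mem_graded ih hu'

lemma units_zpow_conj_mem {R : Type*} [Ring R] (u : Rˣ) (J₀ : Set R)
    (h : (fun j => (u : R) * j * (↑u⁻¹ : R)) '' J₀ = J₀) (n : ℤ) :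
    ∀ j ∈ J₀, ((u ^ n : Rˣ) : R) * j * ((u ^ (-n) : Rˣ) : R) ∈ J₀ := by
  induction n with
  | zero => simp
  | succ n ih =>
    intro j hj
    have := ih _ (h.subset (Set.mem_image_of_mem _ hj))
    rw [zpow_add_one, show -((n : ℤ) + 1) = -1 + -n by ring, zpow_add, zpow_neg_one]
    simpa only [Units.val_mul, mul_assoc] using this
  | pred n ih =>
    intro j hj
    obtain ⟨k, hk, rfl⟩ := h.superset hj
    have := ih k hk
    rw [zpow_sub_one, show -(-(n : ℤ) - 1) = 1 + -(-n) by ring, zpow_add _ 1, zpow_one]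
    simpa only [Units.val_mul, mul_assoc, Units.inv_mul_cancel_left] using this

lemma IsTwoSidedIdeal.smul_mem {R : Type*} [Ring R] [Algebra ℂ R] {J : Set R}
    (hJ : IsTwoSidedIdeal J) (c : ℂ) {a : R} (ha : a ∈ J) : c • a ∈ J := by
  rw [Algebra.smul_def]
  exact (hJ.2.2.2 _ a ha).1

lemma IsTwoSidedIdeal.sum_mem {R : Type*} [Ring R] {J : Set R}
    (hJ : IsTwoSidedIdeal J) {ι : Type*} (s : Finset ι) (f : ι → R)
    (h : ∀ i ∈ s, f i ∈ J) : ∑ i ∈ s, f i ∈ J :=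
  Finset.sum_induction f (· ∈ J) (fun a b ha hb => hJ.2.1 a ha b hb) hJ.1 h

lemma IsTwoSidedIdeal.mem_of_sum_mem {R : Type*} [Ring R] [Algebra ℂ R]
    (𝒜 : ℤ → Submodule ℂ R) (d₀ : ℤ) (hd₀ : d₀ ≠ 0) (E : R)
    (hcomm : ∀ i : ℤ, ∀ a ∈ 𝒜 i, E * a - a * E = (d₀ * i) • a)
    {J : Set R} (hJ : IsTwoSidedIdeal J) (s : Finset ℤ) :
    ∀ f : ℤ → R, (∀ i, f i ∈ 𝒜 i) → ∑ i ∈ s, f i ∈ J → ∀ i ∈ s, f i ∈ J := by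
  induction s using Finset.induction_on with
  | empty => simp
  | insert k s hk ih =>
    intro f hf hsum
    have hsub : ∀ a ∈ J, ∀ b ∈ J, a - b ∈ J := fun a ha b hb => by
      rw [sub_eq_add_neg]
      exact hJ.2.1 a ha _ (hJ.2.2.1 b hb)
    have hscaled : ∑ i ∈ s, ((d₀ * (i - k) : ℤ) : ℂ) • f i ∈ J := by
      have hD := hsub _ (hsub _ (hJ.2.2.2 E _ hsum).1 _ (hJ.2.2.2 E _ hsum).2) _
        (hJ.smul_mem ((d₀ * k : ℤ) : ℂ) hsum)
      convert hD using 1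
      rw [Finset.mul_sum, Finset.sum_mul, Finset.smul_sum, ← Finset.sum_sub_distrib,
        ← Finset.sum_sub_distrib]
      simp only [hcomm _ _ (hf _), Int.cast_smul_eq_zsmul, ← sub_smul, ← mul_sub]
      simp [Finset.sum_insert hk]
    have hs : ∀ i ∈ s, f i ∈ J := by
      intro i hi
      have hmem := ih _ (fun i => (𝒜 i).smul_mem _ (hf i)) hscaled i hi
      have hne : ((d₀ * (i - k) : ℤ) : ℂ) ≠ 0 := by
        rw [Int.cast_ne_zero]
        exact mul_ne_zero hd₀ (sub_ne_zero.mpr (ne_of_mem_of_not_mem hi hk))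
      simpa only [inv_smul_smul₀ hne] using hJ.smul_mem (((d₀ * (i - k) : ℤ) : ℂ)⁻¹) hmem
    intro i hi
    rcases Finset.mem_insert.mp hi with rfl | hi
    · rw [Finset.sum_insert hk] at hsum
      simpa using hsub _ hsum _ (hJ.sum_mem s f hs)
    · exact hs i hi

lemma IsTwoSidedIdeal.decompose_mem {R : Type*} [Ring R] [Algebra ℂ R]
    (𝒜 : ℤ → Submodule ℂ R) [GradedRing 𝒜] (d₀ : ℤ) (hd₀ : d₀ ≠ 0) (E : R)
    (hcomm : ∀ i : ℤ, ∀ a ∈ 𝒜 i, E * a - a * E = (d₀ * i) • a)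
    {J : Set R} (hJ : IsTwoSidedIdeal J) {a : R} (ha : a ∈ J) (i : ℤ) :
    (DirectSum.decompose 𝒜 a i : R) ∈ J := by
  classical
  by_cases hi : i ∈ (DirectSum.decompose 𝒜 a).support
  · refine hJ.mem_of_sum_mem 𝒜 d₀ hd₀ E hcomm _ (fun i => (DirectSum.decompose 𝒜 a i : R))
      (fun i => SetLike.coe_mem _) ?_ i hi
    rwa [DirectSum.sum_support_decompose]
  · rw [DFinsupp.notMem_support_iff.mp hi]
    exact hJ.1

/-- A set determined by homogeneous components lying in the translates `u ^ i * J₀` of an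
invariant ideal `J₀` is a two-sided ideal. -/
lemma isTwoSidedIdeal_of_forall_mem_iff {R : Type*} [Ring R] [Algebra ℂ R]
    (𝒜 : ℤ → Submodule ℂ R) [GradedRing 𝒜]
    (hcomm0 : ∀ a ∈ 𝒜 0, ∀ b ∈ 𝒜 0, a * b = b * a)
    (u : Rˣ) (hu : ∀ i : ℤ, ((u ^ i : Rˣ) : R) ∈ 𝒜 i) {J J₀ : Set R}
    (hJ₀ : IsIdealOfDegZero 𝒜 J₀)
    (hconj : ∀ n : ℤ, ∀ j ∈ J₀, ((u ^ n : Rˣ) : R) * j * ((u ^ (-n) : Rˣ) : R) ∈ J₀)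
    (hJ : ∀ a : R, a ∈ J ↔
      ∀ i : ℤ, ∃ j ∈ J₀, (DirectSum.decompose 𝒜 a i : R) = ((u ^ i : Rˣ) : R) * j) :
    IsTwoSidedIdeal J := by
  classical
  obtain ⟨hsub, hzero, hadd, hneg, hmul⟩ := hJ₀
  have zero_mem : (0 : R) ∈ J := (hJ 0).2 fun i => ⟨0, hzero, by simp⟩
  have add_mem : ∀ a ∈ J, ∀ b ∈ J, a + b ∈ J := fun a ha b hb => (hJ _).2 fun i => by
    obtain ⟨j, hj, hja⟩ := (hJ a).1 ha i
    obtain ⟨k, hk, hkb⟩ := (hJ b).1 hb i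
    exact ⟨j + k, hadd j hj k hk, by simp [hja, hkb, mul_add]⟩
  have neg_mem : ∀ a ∈ J, -a ∈ J := fun a ha => (hJ _).2 fun i => by
    obtain ⟨j, hj, hja⟩ := (hJ a).1 ha i
    exact ⟨-j, hneg j hj, by
      rw [DirectSum.decompose_neg, mul_neg, ← hja]
      rfl⟩
  have sum_mem (s : Finset ℤ) (f : ℤ → R) (h : ∀ i ∈ s, f i ∈ J) : ∑ i ∈ s, f i ∈ J :=
    Finset.sum_induction f (· ∈ J) (fun a b ha hb => add_mem a ha b hb) zero_mem h
  have homogeneous_mem (i : ℤ) (j : R) (hj : j ∈ J₀) : ((u ^ i : Rˣ) : R) * j ∈ J := by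
    have hdeg : ((u ^ i : Rˣ) : R) * j ∈ 𝒜 i := by
      simpa using SetLike.mul_mem_graded (hu i) (hsub hj)
    refine (hJ _).2 fun k => ?_
    by_cases hk : i = k
    · subst hk
      exact ⟨j, hj, DirectSum.decompose_of_mem_same 𝒜 hdeg⟩
    · exact ⟨0, hzero, by rw [DirectSum.decompose_of_mem_ne 𝒜 hdeg hk, mul_zero]⟩
  refine ⟨zero_mem, add_mem, neg_mem, fun r a ha => ⟨?_, ?_⟩⟩
  · rw [← DirectSum.sum_support_decompose 𝒜 r, ← DirectSum.sum_support_decompose 𝒜 a,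
      Finset.sum_mul_sum]
    refine sum_mem _ _ fun k _ => sum_mem _ _ fun i _ => ?_
    obtain ⟨j, hj, hja⟩ := (hJ a).1 ha i
    have hdeg : ((u ^ (-(k + i)) : Rˣ) : R) * (DirectSum.decompose 𝒜 r k : R) *
        ((u ^ i : Rˣ) : R) ∈ 𝒜 0 := by
      have := SetLike.mul_mem_graded (SetLike.mul_mem_graded (hu (-(k + i)))
        (SetLike.coe_mem (DirectSum.decompose 𝒜 r k))) (hu i)
      rwa [show -(k + i) + k + i = 0 by ring] at this
    have := homogeneous_mem (k + i) _ (hmul _ hdeg j hj)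
    rw [hja]
    simpa only [zpow_neg, mul_assoc, Units.mul_inv_cancel_left] using this
  · rw [← DirectSum.sum_support_decompose 𝒜 r, ← DirectSum.sum_support_decompose 𝒜 a,
      Finset.sum_mul_sum]
    refine sum_mem _ _ fun i _ => sum_mem _ _ fun k _ => ?_
    obtain ⟨j, hj, hja⟩ := (hJ a).1 ha i
    have hdeg : ((u ^ (-k) : Rˣ) : R) * (DirectSum.decompose 𝒜 r k : R) ∈ 𝒜 0 := by
      simpa using SetLike.mul_mem_graded (hu (-k)) (SetLike.coe_mem (DirectSum.decompose 𝒜 r k))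
    have hjk := hconj (-k) j hj
    have := homogeneous_mem (i + k) _ (hmul _ hdeg _ hjk)
    rw [hcomm0 _ hdeg _ (hsub hjk), zpow_add] at this
    rw [hja]
    simpa only [zpow_neg, inv_inv, Units.val_mul, mul_assoc, Units.mul_inv_cancel_left]
      using this

/-- Let `R = ⊕_{i∈ℤ} R_i` be a ℤ-graded associative unital
`ℂ`-algebra, with `E ∈ R₀` satisfying `E·a − a·E = d₀·i·a` on `R_i` (`d₀ ≠ 0`),
with `R₀` commutative, and with an element `X ∈ R₁` invertible in `R` whose inverse
`X'` lies in `R₋₁`.  Then a subset `J ⊆ R` is a two-sided ideal of `R` iff there is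
an ideal `J₀` of `R₀` with `X·J₀·X⁻¹ = J₀` such that `J = ⊕_{i∈ℤ} X^i·J₀`
(every homogeneous component of an element of `J` lies in `X^i·J₀`, and conversely);
in that case `J₀ = J ∩ R₀` and also `J = ⊕_{i∈ℤ} J₀·X^i`. -/
theorem stmt_12 {R : Type*} [Ring R] [Algebra ℂ R]
    (𝒜 : ℤ → Submodule ℂ R) [GradedRing 𝒜]
    (d₀ : ℤ) (hd₀ : d₀ ≠ 0) (E : R) (hE : E ∈ 𝒜 0)
    (hcomm : ∀ i : ℤ, ∀ a ∈ 𝒜 i, E * a - a * E = (d₀ * i) • a)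
    (hcomm0 : ∀ a ∈ 𝒜 0, ∀ b ∈ 𝒜 0, a * b = b * a)
    (X X' : R) (hX : X ∈ 𝒜 1) (hX' : X' ∈ 𝒜 (-1))
    (hXX' : X * X' = 1) (hX'X : X' * X = 1)
    (J : Set R) :
    (IsTwoSidedIdeal J ↔
      ∃ J₀ : Set R, IsIdealOfDegZero 𝒜 J₀ ∧
        (fun j => X * j * X') '' J₀ = J₀ ∧
        (∀ a : R, a ∈ J ↔
          ∀ i : ℤ, ∃ j ∈ J₀, (DirectSum.decompose 𝒜 a i : R) = zpow' X X' i * j)) ∧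
    (∀ J₀ : Set R, IsIdealOfDegZero 𝒜 J₀ →
        (fun j => X * j * X') '' J₀ = J₀ →
        (∀ a : R, a ∈ J ↔
          ∀ i : ℤ, ∃ j ∈ J₀, (DirectSum.decompose 𝒜 a i : R) = zpow' X X' i * j) →
        J₀ = J ∩ (𝒜 0 : Set R) ∧
        (∀ a : R, a ∈ J ↔
          ∀ i : ℤ, ∃ j ∈ J₀, (DirectSum.decompose 𝒜 a i : R) = j * zpow' X X' i)) := by
  obtain ⟨u, rfl, rfl⟩ : ∃ u : Rˣ, (u : R) = X ∧ (↑u⁻¹ : R) = X' :=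
    ⟨⟨X, X', hXX', hX'X⟩, rfl, rfl⟩
  have hu := units_zpow_mem 𝒜 u hX hX'
  simp only [zpow'_eq_units_zpow]
  refine ⟨⟨fun hJ => ?_, ?_⟩, ?_⟩
  · refine ⟨J ∩ (𝒜 0 : Set R), ⟨Set.inter_subset_right, ⟨hJ.1, (𝒜 0).zero_mem⟩,
      fun a ha b hb => ⟨hJ.2.1 a ha.1 b hb.1, (𝒜 0).add_mem ha.2 hb.2⟩,
      fun a ha => ⟨hJ.2.2.1 a ha.1, (𝒜 0).neg_mem ha.2⟩,
      fun r hr a ha => ⟨(hJ.2.2.2 r a ha.1).1, ?_⟩⟩, ?_, fun a => ⟨fun ha i => ?_, fun h => ?_⟩⟩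
    · simpa using SetLike.mul_mem_graded hr ha.2
    · ext a
      constructor
      · rintro ⟨j, hj, rfl⟩
        refine ⟨(hJ.2.2.2 _ _ (hJ.2.2.2 _ j hj.1).1).2, ?_⟩
        simpa using SetLike.mul_mem_graded (SetLike.mul_mem_graded hX hj.2) hX'
      · intro ha
        refine ⟨(↑u⁻¹ : R) * a * u, ⟨(hJ.2.2.2 _ _ (hJ.2.2.2 _ a ha.1).1).2, ?_⟩, ?_⟩
        · simpa using SetLike.mul_mem_graded (SetLike.mul_mem_graded hX' ha.2) hX
        · simp [mul_assoc]
    · refine ⟨((u ^ (-i) : Rˣ) : R) * (DirectSum.decompose 𝒜 a i : R),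
        ⟨(hJ.2.2.2 _ _ (hJ.decompose_mem 𝒜 d₀ hd₀ E hcomm ha i)).1, ?_⟩, ?_⟩
      · simpa using SetLike.mul_mem_graded (hu (-i))
          (SetLike.coe_mem (DirectSum.decompose 𝒜 a i))
      · rw [zpow_neg, Units.mul_inv_cancel_left]
    · classical
      rw [← DirectSum.sum_support_decompose 𝒜 a]
      refine hJ.sum_mem _ _ fun i _ => ?_
      obtain ⟨j, hj, hja⟩ := h i
      rw [hja]
      exact (hJ.2.2.2 _ j hj.1).1
  · rintro ⟨J₀, hJ₀, hconj, hJ⟩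
    exact isTwoSidedIdeal_of_forall_mem_iff 𝒜 hcomm0 u hu hJ₀
      (units_zpow_conj_mem u J₀ hconj) hJ
  · intro J₀ hJ₀ hconj hJ
    have hconj' := units_zpow_conj_mem u J₀ hconj
    constructor
    · ext a
      constructor
      · intro ha
        have ha0 : a ∈ 𝒜 0 := hJ₀.1 ha
        refine ⟨(hJ a).2 fun i => ?_, ha0⟩
        by_cases hi : 0 = i
        · subst hi
          exact ⟨a, ha, by simp [DirectSum.decompose_of_mem_same 𝒜 ha0]⟩
        · exact ⟨0, hJ₀.2.1, by rw [DirectSum.decompose_of_mem_ne 𝒜 ha0 hi, mul_zero]⟩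
      · rintro ⟨ha, ha0⟩
        obtain ⟨j, hj, hja⟩ := (hJ a).1 ha 0
        rw [DirectSum.decompose_of_mem_same 𝒜 ha0, zpow_zero, Units.val_one, one_mul] at hja
        rwa [hja]
    · intro a
      rw [hJ]
      refine forall_congr' fun i => ⟨?_, ?_⟩
      · rintro ⟨j, hj, hja⟩
        exact ⟨_, hconj' i j hj, by
          rw [hja, zpow_neg, Units.inv_mul_cancel_right]⟩
      · rintro ⟨j, hj, hja⟩
        refine ⟨_, hconj' (-i) j hj, ?_⟩
        rw [hja, neg_neg, zpow_neg, mul_assoc, Units.mul_inv_cancel_left]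

end GradedStmt12
end

section
/- The set I(M) = {P ∈ ℂ[V]^{W₀} : P vanishes identically on M} equals μ·ℂ[V]^{W₀} (the set of products of μ with a W₀-invariant polynomial function), and one has the direct sum decomposition of ℂ-vector spaces ℂ[V]^{W₀} = ℂ[V]^{W₀,τ} ⊕ I(M). -/
namespace PolyFunStmt

variable (V : Type*) [AddCommGroup V] [Module ℂ V]

/-- The algebra `ℂ[V]` of polynomial functions on `V`: the `ℂ`-subalgebra of the
functions `V → ℂ` generated by the linear forms on `V`. -/
noncomputable def polyFuns : Subalgebra ℂ (V → ℂ) :=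
  Algebra.adjoin ℂ {f : V → ℂ | ∃ φ : V →ₗ[ℂ] ℂ, ⇑φ = f}

variable {V}

/-- The set `ℂ[V]^{W₀}` of `W₀`-invariant polynomial functions on `V`, where
`w ∈ W₀ ⊆ GL(V)` acts on `P` by `(w·P)(v) = P(w⁻¹ v)`. -/
def invPolyFuns (W₀ : Subgroup (Module.End ℂ V)ˣ) : Set (V → ℂ) :=
  {P | P ∈ polyFuns V ∧
    ∀ w ∈ W₀, ∀ v : V, P (((w⁻¹ : (Module.End ℂ V)ˣ) : Module.End ℂ V) v) = P v}

/-- The set `ℂ[V]^{W₀,τ}` of polynomial functions invariant under both `W₀` and the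
translation automorphism `(τP)(v) = P(v − l₀)`. -/
def tauInvPolyFuns (W₀ : Subgroup (Module.End ℂ V)ˣ) (l₀ : V) : Set (V → ℂ) :=
  {P | P ∈ invPolyFuns W₀ ∧ ∀ v : V, P (v - l₀) = P v}

/-- The set `I(M)` of `W₀`-invariant polynomial functions vanishing identically on
`M = ker μ`. -/
def vanishingOnKer (W₀ : Subgroup (Module.End ℂ V)ˣ) (μ : V →ₗ[ℂ] ℂ) : Set (V → ℂ) :=
  {P | P ∈ invPolyFuns W₀ ∧ ∀ v : V, μ v = 0 → P v = 0}

/-- The restriction of a polynomial function to a line is a polynomial in the parameter. -/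
theorem exists_polynomial_eval_line {P : V → ℂ} (hP : P ∈ polyFuns V) (v u : V) :
    ∃ p : Polynomial ℂ, ∀ t : ℂ, P (v + t • u) = p.eval t := by
  induction hP using Algebra.adjoin_induction with
  | mem f hf =>
    obtain ⟨φ, rfl⟩ := hf
    exact ⟨Polynomial.C (φ v) + Polynomial.C (φ u) * Polynomial.X, fun t => by
      simpa using mul_comm t (φ u)⟩
  | algebraMap r => exact ⟨Polynomial.C r, fun t => by simp⟩
  | add f g _ _ hf hg =>
    obtain ⟨p, hp⟩ := hf
    obtain ⟨q, hq⟩ := hg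
    exact ⟨p + q, fun t => by simp [hp, hq]⟩
  | mul f g _ _ hf hg =>
    obtain ⟨p, hp⟩ := hf
    obtain ⟨q, hq⟩ := hg
    exact ⟨p * q, fun t => by simp [hp, hq]⟩

theorem comp_linearMap_mem_polyFuns {P : V → ℂ} (hP : P ∈ polyFuns V) (A : V →ₗ[ℂ] V) :
    P ∘ A ∈ polyFuns V := by
  induction hP using Algebra.adjoin_induction with
  | mem f hf =>
    obtain ⟨φ, rfl⟩ := hf
    exact Algebra.subset_adjoin ⟨φ ∘ₗ A, rfl⟩
  | algebraMap r => exact (polyFuns V).algebraMap_mem r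
  | add f g _ _ hf hg => exact (polyFuns V).add_mem hf hg
  | mul f g _ _ hf hg => exact (polyFuns V).mul_mem hf hg

theorem linearForm_mem_polyFuns (φ : V →ₗ[ℂ] ℂ) : ⇑φ ∈ polyFuns V :=
  Algebra.subset_adjoin ⟨φ, rfl⟩

/-- The projection of `V` onto `ker μ` along `l₀`. -/
noncomputable def kerProj (μ : V →ₗ[ℂ] ℂ) (l₀ : V) : V →ₗ[ℂ] V :=
  LinearMap.id - ((μ l₀)⁻¹ • μ).smulRight l₀

theorem kerProj_apply (μ : V →ₗ[ℂ] ℂ) (l₀ v : V) :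
    kerProj μ l₀ v = v - ((μ l₀)⁻¹ * μ v) • l₀ := by
  simp [kerProj]

theorem map_kerProj (μ : V →ₗ[ℂ] ℂ) {l₀ : V} (hl₀ : μ l₀ ≠ 0) (v : V) :
    μ (kerProj μ l₀ v) = 0 := by
  rw [kerProj_apply, map_sub, map_smul, smul_eq_mul]
  field_simp
  ring

/-- A polynomial function differs from its pullback along the projection onto `ker μ` by a
multiple of `μ`. -/
theorem exists_sub_comp_kerProj_eq_mul (μ : V →ₗ[ℂ] ℂ) (l₀ : V) {P : V → ℂ}
    (hP : P ∈ polyFuns V) :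
    ∃ Q ∈ polyFuns V, P - P ∘ kerProj μ l₀ = ⇑μ * Q := by
  induction hP using Algebra.adjoin_induction with
  | mem f hf =>
    obtain ⟨φ, rfl⟩ := hf
    refine ⟨algebraMap ℂ (V → ℂ) ((μ l₀)⁻¹ * φ l₀), (polyFuns V).algebraMap_mem _, ?_⟩
    ext v
    simp only [Pi.sub_apply, Function.comp_apply, kerProj_apply, map_sub, map_smul, smul_eq_mul,
      Pi.mul_apply, Pi.algebraMap_apply, Algebra.algebraMap_self, RingHom.id_apply]
    ring
  | algebraMap r =>
    refine ⟨0, (polyFuns V).zero_mem, ?_⟩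
    ext v
    simp
  | add f g _ _ hf hg =>
    obtain ⟨p, hp, hfp⟩ := hf
    obtain ⟨q, hq, hgq⟩ := hg
    refine ⟨p + q, (polyFuns V).add_mem hp hq, ?_⟩
    rw [mul_add, ← hfp, ← hgq, Pi.add_comp]
    ring
  | mul f g hf' hg' hf hg =>
    obtain ⟨p, hp, hfp⟩ := hf
    obtain ⟨q, hq, hgq⟩ := hg
    refine ⟨p * g + (f ∘ kerProj μ l₀) * q, (polyFuns V).add_mem ((polyFuns V).mul_mem hp hg')
      ((polyFuns V).mul_mem (comp_linearMap_mem_polyFuns hf' _) hq), ?_⟩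
    rw [Pi.mul_comp]
    linear_combination g * hfp + (f ∘ kerProj μ l₀) * hgq

theorem eq_zero_of_linearForm_mul_eq_zero (μ : V →ₗ[ℂ] ℂ) (hμ : μ ≠ 0) {R : V → ℂ}
    (hR : R ∈ polyFuns V) (h : ∀ v, μ v * R v = 0) : R = 0 := by
  obtain ⟨u, hu⟩ : ∃ u, μ u ≠ 0 := by
    by_contra! hc
    exact hμ (LinearMap.ext hc)
  ext v
  obtain ⟨p, hp⟩ := exists_polynomial_eval_line hR v u
  obtain ⟨q, hq⟩ := exists_polynomial_eval_line (linearForm_mem_polyFuns μ) v u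
  have hqp : q * p = 0 := Polynomial.funext fun t => by
    rw [Polynomial.eval_mul, ← hp, ← hq, h, Polynomial.eval_zero]
  have hq0 : q ≠ 0 := by
    rintro rfl
    have h0 := hq 0
    have h1 := hq 1
    simp only [Polynomial.eval_zero, zero_smul, add_zero, one_smul, map_add] at h0 h1
    exact hu (by simpa [h0] using h1)
  have := hp 0
  simpa [(mul_eq_zero.mp hqp).resolve_left hq0] using this

/-- A translation-invariant polynomial function is constant along the direction of translation. -/
theorem apply_add_smul_of_sub_invariant {P : V → ℂ} (hP : P ∈ polyFuns V) {u : V}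
    (h : ∀ v, P (v - u) = P v) (v : V) (t : ℂ) : P (v + t • u) = P v := by
  obtain ⟨p, hp⟩ := exists_polynomial_eval_line hP v u
  have hn (n : ℕ) : P (v + (n : ℂ) • u) = P v := by
    induction n with
    | zero => simp
    | succ n ih =>
      rw [← h, ← ih]
      congr 1
      push_cast
      module
  have hc : p = Polynomial.C (P v) := by
    refine Polynomial.eq_of_infinite_eval_eq _ _
      ((Set.infinite_range_of_injective (Nat.cast_injective (R := ℂ))).mono ?_)
    rintro _ ⟨n, rfl⟩
    simp [← hp, hn]
  simp [hp, hc]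

theorem kerProj_add_smul (μ : V →ₗ[ℂ] ℂ) (l₀ v : V) :
    kerProj μ l₀ v + ((μ l₀)⁻¹ * μ v) • l₀ = v := by
  simp [kerProj_apply]

theorem sub_mem_invPolyFuns {W₀ : Subgroup (Module.End ℂ V)ˣ} {P Q : V → ℂ}
    (hP : P ∈ invPolyFuns W₀) (hQ : Q ∈ invPolyFuns W₀) : P - Q ∈ invPolyFuns W₀ :=
  ⟨(polyFuns V).sub_mem hP.1 hQ.1, fun w hw v => by simp [hP.2 w hw v, hQ.2 w hw v]⟩

theorem comp_kerProj_mem_tauInvPolyFuns {μ : V →ₗ[ℂ] ℂ} {l₀ : V} (hl₀ : μ l₀ ≠ 0)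
    {W₀ : Subgroup (Module.End ℂ V)ˣ}
    (hWμ : ∀ w ∈ W₀, ∀ v : V, μ ((w : Module.End ℂ V) v) = μ v)
    (hWl : ∀ w ∈ W₀, (w : Module.End ℂ V) l₀ = l₀)
    {P : V → ℂ} (hP : P ∈ invPolyFuns W₀) : P ∘ kerProj μ l₀ ∈ tauInvPolyFuns W₀ l₀ := by
  refine ⟨⟨comp_linearMap_mem_polyFuns hP.1 _, fun w hw v => ?_⟩, fun v => ?_⟩
  · have hw' := W₀.inv_mem hw
    have : kerProj μ l₀ ((w⁻¹ : (Module.End ℂ V)ˣ).val v)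
        = (w⁻¹ : (Module.End ℂ V)ˣ).val (kerProj μ l₀ v) := by
      rw [kerProj_apply, kerProj_apply, map_sub, map_smul, hWl _ hw', hWμ _ hw']
    rw [Function.comp_apply, this, hP.2 w hw, Function.comp_apply]
  · have : kerProj μ l₀ (v - l₀) = kerProj μ l₀ v := by
      rw [map_sub, kerProj_apply μ l₀ l₀, inv_mul_cancel₀ hl₀, one_smul, sub_self, sub_zero]
    rw [Function.comp_apply, this, Function.comp_apply]

/-- `I(M) = μ·ℂ[V]^{W₀}` and
`ℂ[V]^{W₀} = ℂ[V]^{W₀,τ} ⊕ I(M)` (every `W₀`-invariant polynomial function splits as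
a sum of a `(W₀,τ)`-invariant one and one vanishing on `M`, and the two subspaces
intersect trivially). -/
theorem stmt_13 {V : Type*} [AddCommGroup V] [Module ℂ V] [FiniteDimensional ℂ V]
    (μ : V →ₗ[ℂ] ℂ) (hμ : μ ≠ 0) (l₀ : V) (hl₀ : μ l₀ ≠ 0)
    (W₀ : Subgroup (Module.End ℂ V)ˣ) [Finite W₀]
    (hWμ : ∀ w ∈ W₀, ∀ v : V, μ (((w : (Module.End ℂ V)ˣ) : Module.End ℂ V) v) = μ v)
    (hWl : ∀ w ∈ W₀, ((w : (Module.End ℂ V)ˣ) : Module.End ℂ V) l₀ = l₀) :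
    vanishingOnKer W₀ μ = (fun Q : V → ℂ => ⇑μ * Q) '' invPolyFuns W₀ ∧
    (∀ P ∈ invPolyFuns W₀,
      ∃ P₁ ∈ tauInvPolyFuns W₀ l₀, ∃ P₂ ∈ vanishingOnKer W₀ μ, P = P₁ + P₂) ∧
    (∀ P ∈ tauInvPolyFuns W₀ l₀, P ∈ vanishingOnKer W₀ μ → P = 0) := by
  refine ⟨Set.Subset.antisymm ?_ ?_, fun P hP => ?_, fun P hP hP0 => ?_⟩
  · rintro P ⟨hP, hP0⟩
    obtain ⟨Q, hQ, hPQ⟩ := exists_sub_comp_kerProj_eq_mul μ l₀ hP.1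
    have hzero : P ∘ kerProj μ l₀ = 0 := funext fun v => hP0 _ (map_kerProj μ hl₀ v)
    rw [hzero, sub_zero] at hPQ
    refine ⟨Q, ⟨hQ, fun w hw v => ?_⟩, hPQ.symm⟩
    have hR : Q ∘ (w⁻¹ : (Module.End ℂ V)ˣ).val - Q = 0 := by
      refine eq_zero_of_linearForm_mul_eq_zero μ hμ
        ((polyFuns V).sub_mem (comp_linearMap_mem_polyFuns hQ _) hQ) fun v => ?_
      have h := hP.2 w hw v
      rw [hPQ, Pi.mul_apply, Pi.mul_apply, hWμ _ (W₀.inv_mem hw)] at h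
      rw [Pi.sub_apply, Function.comp_apply, mul_sub, h, sub_self]
    exact sub_eq_zero.mp (congrFun hR v)
  · rintro _ ⟨Q, hQ, rfl⟩
    refine ⟨⟨(polyFuns V).mul_mem (linearForm_mem_polyFuns μ) hQ.1, fun w hw v => ?_⟩,
      fun v hv => by simp [hv]⟩
    simp only [Pi.mul_apply]
    rw [hWμ _ (W₀.inv_mem hw), hQ.2 w hw]
  · have hP₁ := comp_kerProj_mem_tauInvPolyFuns hl₀ hWμ hWl hP
    refine ⟨_, hP₁, P - P ∘ kerProj μ l₀, ⟨sub_mem_invPolyFuns hP hP₁.1, fun v hv => ?_⟩,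
      (add_sub_cancel _ _).symm⟩
    simp [kerProj_apply, hv]
  · ext v
    rw [← kerProj_add_smul μ l₀ v, apply_add_smul_of_sub_invariant hP.1.1 hP.2]
    exact hP0.2 _ (map_kerProj μ hl₀ v)

end PolyFunStmt
end
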